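/- arXiv:1201.5790 — 2 statements merged into one kernel-verified Lean document; each statement's English description precedes it below -/
import Mathlib

section
/- Let G be a split graph on d−1 vertices with vertex partition into a clique C and a stable set S, and let ε ∈ {+1,−1}. Then the number of nonempty faces of the Hansen polytope H(G) that are contained in some type-(1)-facet [ε, B] with B ⊆ C, but in no type-(1)-facet [−ε, B'] with B' ⊆ C, equals 3^{d−1}. In particular, the number of positive faces equals the number of negative faces, and both equal 3^{d−1}. -/
/-- A finset of vertices is stable (independent) in `G` if no two of its elements are adjacent. -/
def IsStable {n : ℕ} (G : SimpleGraph (Fin n)) (I : Finset (Fin n)) : Prop :=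
  ∀ ⦃a⦄, a ∈ I → ∀ ⦃b⦄, b ∈ I → ¬ G.Adj a b

/-- The point `e_0 + ∑_{i ∈ I} e_i ∈ ℝ^{n+1}`. -/
def hansenVert {n : ℕ} (I : Finset (Fin n)) : Fin (n + 1) → ℝ :=
  fun j => Fin.cases 1 (fun i => if i ∈ I then 1 else 0) j

/-- The Hansen polytope of `G`. -/
def hansenPolytope {n : ℕ} (G : SimpleGraph (Fin n)) : Set (Fin (n + 1) → ℝ) :=
  convexHull ℝ
    {x | ∃ I : Finset (Fin n), IsStable G I ∧ (x = hansenVert I ∨ x = -hansenVert I)}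

/-- The face `[ε, K] = { x ∈ H(G) : ε·(−x_0 + 2·∑_{i ∈ K} x_i) = 1 }` of the Hansen
polytope, for a sign `ε` and a clique `K`. -/
def hFace {n : ℕ} (G : SimpleGraph (Fin n)) (ε : ℝ) (K : Finset (Fin n)) :
    Set (Fin (n + 1) → ℝ) :=
  {x ∈ hansenPolytope G | ε * (-(x 0) + 2 * (∑ i ∈ K, x i.succ)) = 1}

/-! ### Combinatorics of stable sets in a split graph -/

section Combinatorics

variable {n : ℕ} {G : SimpleGraph (Fin n)} {C S : Finset (Fin n)}

/-- The vertex `s` is adjacent to no clique vertex of `I`. -/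
def Fits (G : SimpleGraph (Fin n)) (C I : Finset (Fin n)) (s : Fin n) : Prop :=
  ∀ c ∈ I, c ∈ C → ¬ G.Adj c s

/-- Given its clique part, the stable set `I` contains every vertex of `S` of sign `1` that it can
and no vertex of `S` of sign `-1`. -/
def IsOpt (G : SimpleGraph (Fin n)) (C S : Finset (Fin n)) (σ : Fin n → SignType)
    (I : Finset (Fin n)) : Prop :=
  ∀ s ∈ S, (σ s = -1 → s ∉ I) ∧ (σ s = 1 → (s ∈ I ↔ Fits G C I s))

/-- The stable sets `I` such that `ε (e_0 + ∑_{i ∈ I} e_i)` lies on the face encoded by `f`. -/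
def SamePattern (G : SimpleGraph (Fin n)) (C S : Finset (Fin n)) (f : Fin n → SignType)
    (I : Finset (Fin n)) : Prop :=
  (∃ c ∈ I, c ∈ C ∧ f c = 1) ∧ IsOpt G C S f I

/-- The stable sets `I` such that `-ε (e_0 + ∑_{i ∈ I} e_i)` lies on the face encoded by `f`. -/
def OppPattern (G : SimpleGraph (Fin n)) (C S : Finset (Fin n)) (f : Fin n → SignType)
    (I : Finset (Fin n)) : Prop :=
  (∀ c ∈ I, c ∈ C → f c = -1) ∧ IsOpt G C S (-f) I

open Classical in
/-- The largest weight of a stable set with the same clique part as `I`. -/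
noncomputable def maxWeight (G : SimpleGraph (Fin n)) (C S : Finset (Fin n)) (a : Fin n → ℝ)
    (I : Finset (Fin n)) : ℝ :=
  ∑ c ∈ C, (if c ∈ I then a c else 0) + ∑ s ∈ S, (if Fits G C I s then max (a s) 0 else 0)

theorem fits_congr {I J : Finset (Fin n)} (h : ∀ c ∈ C, c ∈ I ↔ c ∈ J) (s : Fin n) :
    Fits G C I s ↔ Fits G C J s := by
  unfold Fits; grind

theorem maxWeight_congr {I J : Finset (Fin n)} (h : ∀ c ∈ C, c ∈ I ↔ c ∈ J) (a : Fin n → ℝ) :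
    maxWeight G C S a I = maxWeight G C S a J := by
  classical
  unfold maxWeight
  congr 1
  · exact Finset.sum_congr rfl fun c hc => by simp [h c hc]
  · exact Finset.sum_congr rfl fun s _ => by simp [fits_congr h s]

theorem IsStable.fits {I : Finset (Fin n)} (hI : IsStable G I) {s : Fin n} (hs : s ∈ I) :
    Fits G C I s := fun _ hc _ => hI hc hs

theorem IsStable.eq_of_mem_clique (hC : G.IsClique (↑C : Set (Fin n))) {I : Finset (Fin n)}
    (hI : IsStable G I) {c c' : Fin n} (hc : c ∈ I) (hcC : c ∈ C) (hc' : c' ∈ I)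
    (hcC' : c' ∈ C) : c = c' := by
  by_contra hne
  exact hI hc hc' (hC hcC hcC' hne)

theorem IsStable.mem_iff_mem (hC : G.IsClique (↑C : Set (Fin n))) {I J : Finset (Fin n)}
    (hI : IsStable G I) (hJ : IsStable G J) {c : Fin n} (hcC : c ∈ C) (hcI : c ∈ I)
    (hcJ : c ∈ J) : ∀ b ∈ C, b ∈ I ↔ b ∈ J := fun _ hb =>
  ⟨fun h => hI.eq_of_mem_clique hC hcI hcC h hb ▸ hcJ,
    fun h => hJ.eq_of_mem_clique hC hcJ hcC h hb ▸ hcI⟩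

theorem sum_le_maxWeight (hdisj : Disjoint C S) (hcover : C ∪ S = Finset.univ)
    {I : Finset (Fin n)} (hI : IsStable G I) (a : Fin n → ℝ) :
    ∑ i ∈ I, a i ≤ maxWeight G C S a I ∧
      (∑ i ∈ I, a i = maxWeight G C S a I ↔ IsOpt G C S (fun i => SignType.sign (a i)) I) := by
  classical
  have hsum : ∑ i ∈ I, a i =
      ∑ c ∈ C, (if c ∈ I then a c else 0) + ∑ s ∈ S, (if s ∈ I then a s else 0) := by
    rw [← Finset.sum_union hdisj, hcover]
    simp
  have hle : ∀ s ∈ S, (if s ∈ I then a s else 0) ≤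
      (if Fits G C I s then max (a s) 0 else 0) := by
    intro s _
    by_cases hs : s ∈ I
    · simp [hs, hI.fits hs]
    · simp only [hs, if_false]
      split_ifs <;> simp
  rw [hsum, maxWeight]
  refine ⟨add_le_add_right (Finset.sum_le_sum hle) _, ?_⟩
  rw [add_right_inj, Finset.sum_eq_sum_iff_of_le hle]
  refine forall₂_congr fun s _ => ?_
  by_cases hs : s ∈ I
  · have := hI.fits (C := C) hs
    simp [hs, this, sign_eq_neg_one_iff]
  · simp only [hs, if_false, not_false_eq_true, implies_true, true_and, false_iff,
      sign_eq_one_iff]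
    by_cases hf : Fits G C I s
    · simp [hf]
    · simp [hf]

theorem exists_isOpt (hdisj : Disjoint C S) (hS : IsStable G S) {I : Finset (Fin n)}
    (hI : IsStable G I) (σ : Fin n → SignType) :
    ∃ J, IsStable G J ∧ (∀ c ∈ C, c ∈ J ↔ c ∈ I) ∧ IsOpt G C S σ J ∧
      ∀ s ∈ S, s ∈ J ↔ σ s = 1 ∧ Fits G C I s := by
  classical
  have hCS : ∀ c ∈ C, c ∉ S := fun _ hc => Finset.disjoint_left.mp hdisj hc
  set J : Finset (Fin n) := {i | (i ∈ C ∧ i ∈ I) ∨ (i ∈ S ∧ σ i = 1 ∧ Fits G C I i)} with hJ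
  have hJC : ∀ c ∈ C, c ∈ J ↔ c ∈ I := by
    intro c hc
    simp [hJ, hc, hCS c hc]
  have hJS : ∀ s ∈ S, s ∈ J ↔ σ s = 1 ∧ Fits G C I s := by
    intro s hs
    have : s ∉ C := fun h => hCS s h hs
    simp [hJ, hs, this]
  refine ⟨J, ?_, hJC, ?_, hJS⟩
  · intro u hu v hv
    simp only [hJ, Finset.mem_filter, Finset.mem_univ, true_and] at hu hv
    rcases hu with hu | hu <;> rcases hv with hv | hv
    · exact hI hu.2 hv.2
    · exact hv.2.2 u hu.2 hu.1
    · exact fun h => hu.2.2 v hv.2 hv.1 h.symm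
    · exact hS hu.1 hv.1
  · intro s hs
    rw [hJS s hs, fits_congr hJC s]
    refine ⟨fun h => by simp [h], fun h => by simp [h]⟩

theorem isStable_empty : IsStable G ∅ := fun _ h => by simp at h

theorem isStable_singleton (c : Fin n) : IsStable G {c} := by
  intro a ha b hb
  simp only [Finset.mem_singleton] at ha hb
  simp [ha, hb]

/-- The linear function with values `a0 + ∑_{i ∈ I} a i` attains its maximum over the signed
stable sets at `I` with positive sign. -/
def MaxAt (G : SimpleGraph (Fin n)) (a0 : ℝ) (a : Fin n → ℝ) (I : Finset (Fin n)) : Prop :=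
  ∀ J, IsStable G J → a0 + ∑ i ∈ J, a i ≤ a0 + ∑ i ∈ I, a i ∧
    -(a0 + ∑ i ∈ J, a i) ≤ a0 + ∑ i ∈ I, a i

theorem MaxAt.isOpt (hdisj : Disjoint C S) (hcover : C ∪ S = Finset.univ) (hS : IsStable G S)
    {a0 : ℝ} {a : Fin n → ℝ} {I : Finset (Fin n)} (hI : IsStable G I) (h : MaxAt G a0 a I) :
    IsOpt G C S (fun i => SignType.sign (a i)) I := by
  obtain ⟨J, hJ, hJC, hopt, -⟩ := exists_isOpt hdisj hS hI (fun i => SignType.sign (a i))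
  have h1 := sum_le_maxWeight hdisj hcover hI a
  have h2 := sum_le_maxWeight hdisj hcover hJ a
  rw [← h2.2, maxWeight_congr hJC] at hopt
  have := (h J hJ).1
  exact h1.2.mp (by linarith)

theorem MaxAt.of_isOpt (hdisj : Disjoint C S) (hcover : C ∪ S = Finset.univ)
    (hS : IsStable G S) {a0 : ℝ} {a : Fin n → ℝ} {I J : Finset (Fin n)} (hI : IsStable G I)
    (hJ : IsStable G J) (hIJ : ∀ c ∈ C, c ∈ I ↔ c ∈ J)
    (hopt : IsOpt G C S (fun i => SignType.sign (a i)) I) (h : MaxAt G a0 a J) :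
    MaxAt G a0 a I := by
  have hoptJ := h.isOpt hdisj hcover hS hJ
  rw [← (sum_le_maxWeight hdisj hcover hJ a).2] at hoptJ
  rw [← (sum_le_maxWeight hdisj hcover hI a).2, maxWeight_congr hIJ, ← hoptJ] at hopt
  simpa [MaxAt, hopt] using h

theorem exists_pattern_of_maxAt (hdisj : Disjoint C S) (hcover : C ∪ S = Finset.univ)
    (hC : G.IsClique (↑C : Set (Fin n))) (hS : IsStable G S) (a0 : ℝ) (a : Fin n → ℝ)
    (hpos : ∀ I, IsStable G I → MaxAt G a0 a I → ∃ c ∈ I, c ∈ C)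
    (hneg : ∃ I, IsStable G I ∧ MaxAt G (-a0) (-a) I ∧ ∀ c ∈ I, c ∉ C)
    (hsep : ∀ I J, IsStable G I → IsStable G J → MaxAt G a0 a I → MaxAt G (-a0) (-a) J →
      ∀ c ∈ I, c ∈ C → c ∉ J) :
    ∃ f : Fin n → SignType, ∀ I, IsStable G I →
      (MaxAt G a0 a I ↔ SamePattern G C S f I) ∧
      (MaxAt G (-a0) (-a) I ↔ OppPattern G C S f I) := by
  classical
  have hCS : ∀ c ∈ C, c ∉ S := fun _ hc => Finset.disjoint_left.mp hdisj hc
  let f : Fin n → SignType := fun i =>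
    if i ∈ S then SignType.sign (a i)
    else if ∃ I, IsStable G I ∧ MaxAt G a0 a I ∧ i ∈ I then 1
    else if ∃ I, IsStable G I ∧ MaxAt G (-a0) (-a) I ∧ i ∈ I then -1 else 0
  have hfS : ∀ s ∈ S, f s = SignType.sign (a s) := fun s hs => by simp [f, hs]
  have hopt1 : ∀ I, IsOpt G C S f I ↔ IsOpt G C S (fun i => SignType.sign (a i)) I := fun I =>
    forall₂_congr fun s hs => by rw [hfS s hs]
  have hopt2 : ∀ I, IsOpt G C S (-f) I ↔ IsOpt G C S (fun i => SignType.sign ((-a) i)) I :=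
    fun I => forall₂_congr fun s hs => by
      simp only [Pi.neg_apply, hfS s hs, Left.sign_neg]
  have hfp : ∀ c ∈ C, f c = 1 ↔ ∃ I, IsStable G I ∧ MaxAt G a0 a I ∧ c ∈ I := by
    intro c hc
    simp only [f, hCS c hc, if_false]
    split_ifs with h1 h2 <;> simp_all
  have hfn : ∀ c ∈ C, f c = -1 ↔ ∃ I, IsStable G I ∧ MaxAt G (-a0) (-a) I ∧ c ∈ I := by
    intro c hc
    have : (∃ I, IsStable G I ∧ MaxAt G a0 a I ∧ c ∈ I) →
        ¬ ∃ I, IsStable G I ∧ MaxAt G (-a0) (-a) I ∧ c ∈ I := by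
      rintro ⟨I, hI, hm, hcI⟩ ⟨J, hJ, hm', hcJ⟩
      exact hsep I J hI hJ hm hm' c hcI hc hcJ
    simp only [f, hCS c hc, if_false]
    split_ifs with h1 h2
    · simpa using this h1
    · simpa using h2
    · simpa using h2
  refine ⟨f, fun I hI => ⟨⟨fun h => ?_, fun h => ?_⟩, ⟨fun h => ?_, fun h => ?_⟩⟩⟩
  · obtain ⟨c, hcI, hcC⟩ := hpos I hI h
    exact ⟨⟨c, hcI, hcC, (hfp c hcC).2 ⟨I, hI, h, hcI⟩⟩,
      (hopt1 I).2 (h.isOpt hdisj hcover hS hI)⟩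
  · obtain ⟨⟨c, hcI, hcC, hfc⟩, hopt⟩ := h
    obtain ⟨J, hJ, hm, hcJ⟩ := (hfp c hcC).1 hfc
    exact MaxAt.of_isOpt hdisj hcover hS hI hJ (hI.mem_iff_mem hC hJ hcC hcI hcJ)
      ((hopt1 I).1 hopt) hm
  · exact ⟨fun c hcI hcC => (hfn c hcC).2 ⟨I, hI, h, hcI⟩,
      (hopt2 I).2 (h.isOpt hdisj hcover hS hI)⟩
  · obtain ⟨hf, hopt⟩ := h
    by_cases hcore : ∃ c ∈ I, c ∈ C
    · obtain ⟨c, hcI, hcC⟩ := hcore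
      obtain ⟨J, hJ, hm, hcJ⟩ := (hfn c hcC).1 (hf c hcI hcC)
      exact MaxAt.of_isOpt hdisj hcover hS hI hJ (hI.mem_iff_mem hC hJ hcC hcI hcJ)
        ((hopt2 I).1 hopt) hm
    · obtain ⟨J, hJ, hm, hJC⟩ := hneg
      refine MaxAt.of_isOpt hdisj hcover hS hI hJ (fun c hc => ?_) ((hopt2 I).1 hopt) hm
      exact ⟨fun h => (hcore ⟨c, h, hc⟩).elim, fun h => (hJC c h hc).elim⟩

theorem exists_weights_of_pattern (hdisj : Disjoint C S) (hcover : C ∪ S = Finset.univ)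
    (hC : G.IsClique (↑C : Set (Fin n))) (hS : IsStable G S) (f : Fin n → SignType) :
    ∃ (a0 : ℝ) (a : Fin n → ℝ), ∀ I, IsStable G I →
      (MaxAt G a0 a I ↔ SamePattern G C S f I) ∧
      (MaxAt G (-a0) (-a) I ↔ OppPattern G C S f I) := by
  classical
  have hCS : ∀ c ∈ C, c ∉ S := fun _ hc => Finset.disjoint_left.mp hdisj hc
  let p : ℝ := ∑ s ∈ S, max (f s : ℝ) 0
  let m : ℝ := ∑ s ∈ S, max (-(f s : ℝ)) 0
  let pc : Fin n → ℝ := fun c => ∑ s ∈ S, if G.Adj c s then max (f s : ℝ) 0 else 0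
  let mc : Fin n → ℝ := fun c => ∑ s ∈ S, if G.Adj c s then max (-(f s : ℝ)) 0 else 0
  have hpc : ∀ c, 0 ≤ pc c := fun c => Finset.sum_nonneg fun s _ => by positivity
  have hmc : ∀ c, 0 ≤ mc c := fun c => Finset.sum_nonneg fun s _ => by positivity
  let a : Fin n → ℝ := fun i =>
    if i ∈ S then (f i : ℝ) else if f i = 1 then 1 + pc i else if f i = -1 then -mc i else 1 / 2
  let a0 : ℝ := (m - p - 1) / 2
  let M : ℝ := (m + p + 1) / 2
  have haS : ∀ s ∈ S, a s = f s := fun s hs => by simp [a, hs]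
  have hsgn : ∀ s ∈ S, SignType.sign (a s) = f s := fun s hs => by
    rw [haS s hs]; cases f s <;> simp
  have hopt1 : ∀ I, IsOpt G C S (fun i => SignType.sign (a i)) I ↔ IsOpt G C S f I := fun I =>
    forall₂_congr fun s hs => by simp only [hsgn s hs]
  have hopt2 : ∀ I, IsOpt G C S (fun i => SignType.sign ((-a) i)) I ↔ IsOpt G C S (-f) I :=
    fun I => forall₂_congr fun s hs => by
      simp only [Pi.neg_apply, Left.sign_neg, hsgn s hs]
  have hU0 : ∀ I : Finset (Fin n), (∀ c ∈ I, c ∉ C) → maxWeight G C S a I = p ∧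
      maxWeight G C S (-a) I = m := by
    intro I hI
    have h1 : ∀ s, Fits G C I s := fun s c hc hcC => (hI c hc hcC).elim
    have h2 : ∀ b : Fin n → ℝ, ∑ c ∈ C, (if c ∈ I then b c else 0) = 0 := fun b =>
      Finset.sum_eq_zero fun c hc => by rw [if_neg fun h => hI c h hc]
    simp only [maxWeight, h1, h2, if_true, zero_add, Pi.neg_apply]
    exact ⟨Finset.sum_congr rfl fun s hs => by rw [haS s hs],
      Finset.sum_congr rfl fun s hs => by rw [haS s hs]⟩
  have hU1 : ∀ I : Finset (Fin n), IsStable G I → ∀ c ∈ I, c ∈ C →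
      maxWeight G C S a I = a c + (p - pc c) ∧ maxWeight G C S (-a) I = -a c + (m - mc c) := by
    intro I hI c hcI hcC
    have h1 : ∀ s, Fits G C I s ↔ ¬ G.Adj c s := fun s =>
      ⟨fun h => h c hcI hcC, fun h b hb hbC => hI.eq_of_mem_clique hC hcI hcC hb hbC ▸ h⟩
    have h2 : ∀ b : Fin n → ℝ, ∑ i ∈ C, (if i ∈ I then b i else 0) = b c := by
      intro b
      rw [Finset.sum_eq_single_of_mem c hcC, if_pos hcI]
      intro i hi hic
      rw [if_neg fun h => hic (hI.eq_of_mem_clique hC h hi hcI hcC)]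
    simp only [maxWeight, h1, h2, Pi.neg_apply, p, pc, m, mc, ← Finset.sum_sub_distrib]
    constructor <;> congr 1 <;> refine Finset.sum_congr rfl fun s hs => ?_ <;>
      rw [haS s hs] <;> split_ifs <;> simp_all
  have hac : ∀ c ∈ C, (-mc c ≤ a c ∧ (a c = -mc c ↔ f c = -1)) ∧
      (a c ≤ 1 + pc c ∧ (a c = 1 + pc c ↔ f c = 1)) := by
    intro c hc
    have h1 := hpc c
    have h2 := hmc c
    simp only [a, hCS c hc, if_false]
    split_ifs with h3 h4
    · rw [h3]
      refine ⟨⟨by linarith, ?_⟩, le_rfl, by simp⟩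
      exact ⟨fun h => by linarith, fun h => by simp at h⟩
    · rw [h4]
      refine ⟨⟨le_rfl, by simp⟩, by linarith, ?_⟩
      exact ⟨fun h => by linarith, fun h => by simp at h⟩
    · refine ⟨⟨by linarith, ?_⟩, by linarith, ?_⟩
      · exact ⟨fun h => by linarith, fun h => (h4 h).elim⟩
      · exact ⟨fun h => by linarith, fun h => (h3 h).elim⟩
  have key1 : ∀ I, IsStable G I → a0 + ∑ i ∈ I, a i ≤ M ∧
      (a0 + ∑ i ∈ I, a i = M ↔ SamePattern G C S f I) := by
    intro I hI
    obtain ⟨hle, heq⟩ := sum_le_maxWeight hdisj hcover hI a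
    rw [hopt1] at heq
    unfold SamePattern
    rw [← heq]
    by_cases hcore : ∃ c ∈ I, c ∈ C
    · obtain ⟨c, hcI, hcC⟩ := hcore
      obtain ⟨hu, -⟩ := hU1 I hI c hcI hcC
      obtain ⟨-, h1, h2⟩ := hac c hcC
      have h3 : (∃ b ∈ I, b ∈ C ∧ f b = 1) ↔ f c = 1 :=
        ⟨fun ⟨b, hb, hbC, h⟩ => hI.eq_of_mem_clique hC hcI hcC hb hbC ▸ h,
          fun h => ⟨c, hcI, hcC, h⟩⟩
      rw [h3, ← h2]
      rw [hu] at hle ⊢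
      simp only [a0, M]
      exact ⟨by linarith, fun h => ⟨by linarith, by linarith⟩, fun h => by linarith [h.1, h.2]⟩
    · push Not at hcore
      rw [(hU0 I hcore).1] at hle
      simp only [a0, M]
      refine ⟨by linarith, fun h => by linarith, ?_⟩
      rintro ⟨⟨c, hcI, hcC, -⟩, -⟩
      exact (hcore c hcI hcC).elim
  have key2 : ∀ I, IsStable G I → -a0 + ∑ i ∈ I, (-a) i ≤ M ∧
      (-a0 + ∑ i ∈ I, (-a) i = M ↔ OppPattern G C S f I) := by
    intro I hI
    obtain ⟨hle, heq⟩ := sum_le_maxWeight hdisj hcover hI (-a)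
    rw [hopt2] at heq
    unfold OppPattern
    rw [← heq]
    by_cases hcore : ∃ c ∈ I, c ∈ C
    · obtain ⟨c, hcI, hcC⟩ := hcore
      obtain ⟨-, hu⟩ := hU1 I hI c hcI hcC
      obtain ⟨⟨h1, h2⟩, -⟩ := hac c hcC
      have h3 : (∀ b ∈ I, b ∈ C → f b = -1) ↔ f c = -1 :=
        ⟨fun h => h c hcI hcC,
          fun h b hb hbC => hI.eq_of_mem_clique hC hcI hcC hb hbC ▸ h⟩
      rw [h3, ← h2]
      rw [hu] at hle ⊢
      simp only [a0, M]
      exact ⟨by linarith, fun h => ⟨by linarith, by linarith⟩, fun h => by linarith [h.1, h.2]⟩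
    · push Not at hcore
      rw [(hU0 I hcore).2] at hle ⊢
      simp only [a0, M]
      exact ⟨by linarith, fun h => ⟨fun c hcI hcC => (hcore c hcI hcC).elim, by linarith⟩,
        fun h => by linarith [h.2]⟩
  have hneg : ∀ J : Finset (Fin n), -a0 + ∑ i ∈ J, (-a) i = -(a0 + ∑ i ∈ J, a i) := fun J => by
    simp only [Pi.neg_apply, Finset.sum_neg_distrib]; ring
  obtain ⟨I₀, hI₀, hI₀C, hI₀opt, -⟩ := exists_isOpt hdisj hS (isStable_empty (G := G)) (-f)
  have hM : -a0 + ∑ i ∈ I₀, (-a) i = M :=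
    (key2 I₀ hI₀).2.mpr ⟨fun c hc hcC => by simpa using (hI₀C c hcC).1 hc, hI₀opt⟩
  refine ⟨a0, a, fun I hI => ⟨?_, ?_⟩⟩
  · rw [← (key1 I hI).2]
    refine ⟨fun h => ?_, fun h J hJ => ?_⟩
    · have h1 := (h I₀ hI₀).2
      rw [← hneg, hM] at h1
      exact le_antisymm (key1 I hI).1 h1
    · rw [h, ← hneg]
      exact ⟨(key1 J hJ).1, (key2 J hJ).1⟩
  · rw [← (key2 I hI).2]
    refine ⟨fun h => ?_, fun h J hJ => ?_⟩
    · have h1 := (h I₀ hI₀).1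
      rw [hM] at h1
      exact le_antisymm (key2 I hI).1 h1
    · rw [h]
      refine ⟨(key2 J hJ).1, ?_⟩
      rw [hneg, neg_neg]
      exact (key1 J hJ).1

theorem eq_one_imp_of_pattern_imp (hdisj : Disjoint C S) (hS : IsStable G S)
    {f g : Fin n → SignType}
    (h1 : ∀ I, IsStable G I → SamePattern G C S f I → SamePattern G C S g I)
    (h2 : ∀ I, IsStable G I → OppPattern G C S f I → OppPattern G C S g I) :
    (∀ c ∈ C, f c = 1 → g c = 1) ∧ (∀ c ∈ C, f c = -1 → g c = -1) ∧
      (∀ s ∈ S, g s = 1 → f s = 1) ∧ ∀ s ∈ S, g s = -1 → f s = -1 := by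
  classical
  have hCS : ∀ c ∈ C, c ∉ S := fun _ hc => Finset.disjoint_left.mp hdisj hc
  refine ⟨fun c hc hf => ?_, fun c hc hf => ?_, fun s hs hg => ?_, fun s hs hg => ?_⟩
  · obtain ⟨J, hJ, hJC, hopt, -⟩ := exists_isOpt hdisj hS (isStable_singleton (G := G) c) f
    obtain ⟨⟨b, hb, hbC, hgb⟩, -⟩ := h1 J hJ ⟨⟨c, (hJC c hc).2 (by simp), hc, hf⟩, hopt⟩
    have := (hJC b hbC).1 hb
    rw [Finset.mem_singleton] at this
    exact this ▸ hgb
  · obtain ⟨J, hJ, hJC, hopt, -⟩ := exists_isOpt hdisj hS (isStable_singleton (G := G) c) (-f)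
    refine (h2 J hJ ⟨fun b hb hbC => ?_, hopt⟩).1 c ((hJC c hc).2 (by simp)) hc
    have := (hJC b hbC).1 hb
    rw [Finset.mem_singleton] at this
    exact this ▸ hf
  · by_contra hf
    have hI : IsStable G ({i ∈ S | f i ≠ 1} : Finset (Fin n)) := fun a ha b hb =>
      hS (Finset.mem_filter.1 ha).1 (Finset.mem_filter.1 hb).1
    have hF : ∀ s, Fits G C ({i ∈ S | f i ≠ 1} : Finset (Fin n)) s := fun s c hc hcC =>
      (hCS c hcC (Finset.mem_filter.1 hc).1).elim
    have := (h2 _ hI ⟨fun c hc hcC => (hCS c hcC (Finset.mem_filter.1 hc).1).elim,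
      fun t ht => ⟨fun h => ?_, fun h => ?_⟩⟩).2 s hs
    · exact this.1 (by simp [hg]) (by simp [hs, hf])
    · simp only [Pi.neg_apply, neg_inj] at h
      simp [h]
    · have : f t = -1 := neg_eq_iff_eq_neg.mp h
      simp [hF, ht, this]
  · obtain ⟨J, hJ, hJC, hopt, hJS⟩ := exists_isOpt hdisj hS (isStable_empty (G := G)) (-f)
    have hnot : ∀ c ∈ J, c ∉ C := fun c hc hcC => by simpa using (hJC c hcC).1 hc
    have := ((h2 J hJ ⟨fun c hc hcC => (hnot c hc hcC).elim, hopt⟩).2 s hs).2 (by simp [hg])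
    have := ((hJS s hs).1 (this.2 fun c hc hcC => (hnot c hc hcC).elim)).1
    exact neg_eq_iff_eq_neg.mp this

theorem eq_of_pattern_iff (hdisj : Disjoint C S) (hcover : C ∪ S = Finset.univ)
    (hS : IsStable G S) {f g : Fin n → SignType}
    (h1 : ∀ I, IsStable G I → (SamePattern G C S f I ↔ SamePattern G C S g I))
    (h2 : ∀ I, IsStable G I → (OppPattern G C S f I ↔ OppPattern G C S g I)) : f = g := by
  obtain ⟨a1, a2, a3, a4⟩ := eq_one_imp_of_pattern_imp hdisj hS
    (fun I hI => (h1 I hI).1) (fun I hI => (h2 I hI).1)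
  obtain ⟨b1, b2, b3, b4⟩ := eq_one_imp_of_pattern_imp hdisj hS
    (fun I hI => (h1 I hI).2) (fun I hI => (h2 I hI).2)
  have key : ∀ x y : SignType, (x = 1 ↔ y = 1) → (x = -1 ↔ y = -1) → x = y := by decide
  funext i
  have hi : i ∈ C ∪ S := hcover ▸ Finset.mem_univ i
  rcases Finset.mem_union.1 hi with hi | hi
  · exact key _ _ ⟨a1 i hi, b1 i hi⟩ ⟨a2 i hi, b2 i hi⟩
  · exact key _ _ ⟨b3 i hi, a3 i hi⟩ ⟨b4 i hi, a4 i hi⟩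

end Combinatorics

/-! ### Faces of the Hansen polytope -/

section Geometry

variable {n : ℕ} {G : SimpleGraph (Fin n)} {C S : Finset (Fin n)} {ε : ℝ}

theorem smul_hansenVert_mem (hε : ε = 1 ∨ ε = -1) {I : Finset (Fin n)} (hI : IsStable G I) :
    ε • hansenVert I ∈ hansenPolytope G ∧ -(ε • hansenVert I) ∈ hansenPolytope G := by
  have h1 : hansenVert I ∈ hansenPolytope G := subset_convexHull ℝ _ ⟨I, hI, Or.inl rfl⟩
  have h2 : -hansenVert I ∈ hansenPolytope G := subset_convexHull ℝ _ ⟨I, hI, Or.inr rfl⟩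
  rcases hε with rfl | rfl <;> simp [h1, h2]

theorem hansenPolytope_eq (G : SimpleGraph (Fin n)) (hε : ε = 1 ∨ ε = -1) :
    hansenPolytope G = convexHull ℝ
      {x | ∃ I, IsStable G I ∧ (x = ε • hansenVert I ∨ x = -(ε • hansenVert I))} := by
  rcases hε with rfl | rfl
  · simp [hansenPolytope]
  · simp [hansenPolytope, or_comm]

theorem finite_hansen_vertices (G : SimpleGraph (Fin n)) (ε : ℝ) :
    {x | ∃ I, IsStable G I ∧ (x = ε • hansenVert I ∨ x = -(ε • hansenVert I))}.Finite := by
  refine ((Set.finite_range fun I : Finset (Fin n) => ε • hansenVert I).union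
    (Set.finite_range fun I : Finset (Fin n) => -(ε • hansenVert I))).subset ?_
  rintro x ⟨I, -, rfl | rfl⟩
  · exact Or.inl ⟨I, rfl⟩
  · exact Or.inr ⟨I, rfl⟩

/-- An exposed face of the convex hull of a finite set is the hull of the points it contains. -/
theorem IsExposed.subset_convexHull_inter {E : Type*} [AddCommGroup E] [Module ℝ E]
    [TopologicalSpace E] [T2Space E] [IsTopologicalAddGroup E] [ContinuousSMul ℝ E]
    [LocallyConvexSpace ℝ E] {V F : Set E} (hV : V.Finite)
    (hF : IsExposed ℝ (convexHull ℝ V) F) : F ⊆ convexHull ℝ (F ∩ V) := by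
  have hcomp : IsCompact (convexHull ℝ V) := hV.isCompact_convexHull ℝ
  have hconv : Convex ℝ F := hF.convex (convex_convexHull ℝ V)
  have hext : F.extremePoints ℝ ⊆ F ∩ V := fun x hx =>
    ⟨hx.1, extremePoints_convexHull_subset (hF.isExtreme.extremePoints_subset_extremePoints hx)⟩
  have hclosed : IsClosed (convexHull ℝ (F ∩ V)) :=
    ((hV.subset Set.inter_subset_right).isCompact_convexHull ℝ).isClosed
  exact (closure_convexHull_extremePoints (hF.isCompact hcomp) hconv).symm.subset.trans
    (closure_minimal (convexHull_mono hext) hclosed)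

theorem IsExposed.subset_of_hansenVert (hε : ε = 1 ∨ ε = -1) {F T : Set (Fin (n + 1) → ℝ)}
    (hF : IsExposed ℝ (hansenPolytope G) F) (hT : Convex ℝ T)
    (h : ∀ I, IsStable G I → (ε • hansenVert I ∈ F → ε • hansenVert I ∈ T) ∧
      (-(ε • hansenVert I) ∈ F → -(ε • hansenVert I) ∈ T)) : F ⊆ T := by
  rw [hansenPolytope_eq G hε] at hF
  refine (hF.subset_convexHull_inter (finite_hansen_vertices G ε)).trans (convexHull_min ?_ hT)
  rintro x ⟨hx, I, hI, rfl | rfl⟩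
  · exact (h I hI).1 hx
  · exact (h I hI).2 hx

theorem IsExposed.eq_of_hansenVert (hε : ε = 1 ∨ ε = -1) {F T : Set (Fin (n + 1) → ℝ)}
    (hF : IsExposed ℝ (hansenPolytope G) F) (hT : IsExposed ℝ (hansenPolytope G) T)
    (h : ∀ I, IsStable G I → (ε • hansenVert I ∈ F ↔ ε • hansenVert I ∈ T) ∧
      (-(ε • hansenVert I) ∈ F ↔ -(ε • hansenVert I) ∈ T)) : F = T :=
  (hF.subset_of_hansenVert hε (hT.convex (convex_convexHull ℝ _))
    fun I hI => ⟨(h I hI).1.1, (h I hI).2.1⟩).antisymm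
  (hT.subset_of_hansenVert hε (hF.convex (convex_convexHull ℝ _))
    fun I hI => ⟨(h I hI).1.2, (h I hI).2.2⟩)

theorem convex_hFace (G : SimpleGraph (Fin n)) (ε : ℝ) (K : Finset (Fin n)) :
    Convex ℝ (hFace G ε K) := by
  intro x hx y hy s t hs ht hst
  refine ⟨convex_convexHull ℝ _ hx.1 hy.1 hs ht hst, ?_⟩
  have h1 := hx.2
  have h2 := hy.2
  simp only [Pi.add_apply, Pi.smul_apply, smul_eq_mul, Finset.sum_add_distrib, ← Finset.mul_sum]
  linear_combination s * h1 + t * h2 + hst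

theorem smul_hansenVert_mem_hFace (hε : ε = 1 ∨ ε = -1) {I : Finset (Fin n)}
    (hI : IsStable G I) (K : Finset (Fin n)) :
    (ε • hansenVert I ∈ hFace G ε K ↔ (K ∩ I).card = 1) ∧
      (-(ε • hansenVert I) ∈ hFace G ε K ↔ K ∩ I = ∅) := by
  have hsum : ∑ i ∈ K, hansenVert I i.succ = ((K ∩ I).card : ℝ) := by
    simp [hansenVert, Finset.sum_ite_mem]
  have h0 : hansenVert I 0 = 1 := rfl
  have hsq : ε * ε = 1 := by rcases hε with rfl | rfl <;> norm_num
  obtain ⟨hm1, hm2⟩ := smul_hansenVert_mem hε hI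
  simp only [hFace, Set.mem_ofPred_eq, hm1, hm2, true_and, Pi.smul_apply, Pi.neg_apply,
    smul_eq_mul, Finset.sum_neg_distrib, ← Finset.mul_sum, hsum, h0]
  constructor
  · rw [← Nat.cast_inj (R := ℝ), Nat.cast_one]
    constructor
    · intro h
      linear_combination h / 2 - (-1 + 2 * ((K ∩ I).card : ℝ)) * hsq / 2
    · intro h
      rw [h]
      linear_combination hsq
  · rw [← Finset.card_eq_zero, ← Nat.cast_inj (R := ℝ), Nat.cast_zero]
    constructor
    · intro h
      linear_combination -h / 2 + (1 - 2 * ((K ∩ I).card : ℝ)) * hsq / 2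
    · intro h
      rw [h]
      linear_combination hsq

theorem IsExposed.subset_hFace_iff (hε : ε = 1 ∨ ε = -1) {F : Set (Fin (n + 1) → ℝ)}
    (hF : IsExposed ℝ (hansenPolytope G) F) (K : Finset (Fin n)) :
    F ⊆ hFace G ε K ↔ ∀ I, IsStable G I → (ε • hansenVert I ∈ F → (K ∩ I).card = 1) ∧
      (-(ε • hansenVert I) ∈ F → K ∩ I = ∅) := by
  refine ⟨fun h I hI => ?_, fun h => hF.subset_of_hansenVert hε (convex_hFace G ε K) fun I hI => ?_⟩
  · rw [← (smul_hansenVert_mem_hFace hε hI K).1, ← (smul_hansenVert_mem_hFace hε hI K).2]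
    exact ⟨fun hx => h hx, fun hx => h hx⟩
  · rw [(smul_hansenVert_mem_hFace hε hI K).1, (smul_hansenVert_mem_hFace hε hI K).2]
    exact h I hI

theorem IsExposed.subset_hFace_neg_iff (hε : ε = 1 ∨ ε = -1) {F : Set (Fin (n + 1) → ℝ)}
    (hF : IsExposed ℝ (hansenPolytope G) F) (K : Finset (Fin n)) :
    F ⊆ hFace G (-ε) K ↔ ∀ I, IsStable G I → (ε • hansenVert I ∈ F → K ∩ I = ∅) ∧
      (-(ε • hansenVert I) ∈ F → (K ∩ I).card = 1) := by
  have hε' : -ε = 1 ∨ -ε = -1 := by rcases hε with rfl | rfl <;> simp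
  rw [hF.subset_hFace_iff hε' K]
  simp only [neg_smul, neg_neg]
  exact forall₂_congr fun I _ => and_comm

/-- An exposed face with a given pattern is positive relative to the sign `ε`. -/
theorem subset_hFace_of_pattern (hdisj : Disjoint C S) (hC : G.IsClique (↑C : Set (Fin n)))
    (hS : IsStable G S) (hε : ε = 1 ∨ ε = -1) {F : Set (Fin (n + 1) → ℝ)}
    (hF : IsExposed ℝ (hansenPolytope G) F) {f : Fin n → SignType}
    (hf : ∀ I, IsStable G I → (ε • hansenVert I ∈ F ↔ SamePattern G C S f I) ∧
      (-(ε • hansenVert I) ∈ F ↔ OppPattern G C S f I)) :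
    F.Nonempty ∧ (∃ B ⊆ C, F ⊆ hFace G ε B) ∧ ∀ B' ⊆ C, ¬ F ⊆ hFace G (-ε) B' := by
  classical
  obtain ⟨J, hJ, hJC, hopt, -⟩ := exists_isOpt hdisj hS (isStable_empty (G := G)) (-f)
  have hnot : ∀ c ∈ J, c ∉ C := fun c hc hcC => by simpa using (hJC c hcC).1 hc
  have hJF : -(ε • hansenVert J) ∈ F :=
    (hf J hJ).2.2 ⟨fun c hc hcC => (hnot c hc hcC).elim, hopt⟩
  refine ⟨⟨_, hJF⟩, ⟨{c ∈ C | f c = 1}, Finset.filter_subset _ _, ?_⟩, fun B hB hFB => ?_⟩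
  · rw [hF.subset_hFace_iff hε]
    intro I hI
    rw [(hf I hI).1, (hf I hI).2]
    refine ⟨fun ⟨⟨c, hcI, hcC, hfc⟩, _⟩ => ?_, fun ⟨h, _⟩ => ?_⟩
    · rw [Finset.card_eq_one]
      refine ⟨c, Finset.eq_singleton_iff_unique_mem.2 ⟨by simp [*], fun b hb => ?_⟩⟩
      simp only [Finset.mem_inter, Finset.mem_filter] at hb
      exact hI.eq_of_mem_clique hC hb.2 hb.1.1 hcI hcC
    · rw [Finset.eq_empty_iff_forall_notMem]
      intro c hc
      simp only [Finset.mem_inter, Finset.mem_filter] at hc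
      have := h c hc.2 hc.1.1
      rw [hc.1.2] at this
      exact absurd this (by decide)
  · rw [hF.subset_hFace_neg_iff hε] at hFB
    have h1 := (hFB J hJ).2 hJF
    have h2 : B ∩ J = ∅ := by
      rw [Finset.eq_empty_iff_forall_notMem]
      intro c hc
      rw [Finset.mem_inter] at hc
      exact hnot c hc.2 (hB hc.1)
    simp [h2] at h1

theorem map_hansenVert (l : StrongDual ℝ (Fin (n + 1) → ℝ)) (I : Finset (Fin n)) :
    l (hansenVert I) = l (Pi.single 0 1) + ∑ i ∈ I, l (Pi.single i.succ 1) := by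
  have : hansenVert I = Pi.single 0 1 + ∑ i ∈ I, Pi.single i.succ (1 : ℝ) := by
    funext j
    refine Fin.cases ?_ (fun i => ?_) j
    · simp [hansenVert, Finset.sum_apply]
    · simp [hansenVert, Finset.sum_apply, Pi.single_apply]
  rw [this, map_add, map_sum]

theorem exists_weights_of_dual (ε : ℝ) (l : StrongDual ℝ (Fin (n + 1) → ℝ)) :
    ∃ (a0 : ℝ) (a : Fin n → ℝ), ∀ I, l (ε • hansenVert I) = a0 + ∑ i ∈ I, a i := by
  refine ⟨ε * l (Pi.single 0 1), fun i => ε * l (Pi.single i.succ 1), fun I => ?_⟩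
  rw [map_smul, map_hansenVert, smul_eq_mul, ← Finset.mul_sum, mul_add]

theorem exists_dual_of_weights (hε : ε = 1 ∨ ε = -1) (a0 : ℝ) (a : Fin n → ℝ) :
    ∃ l : StrongDual ℝ (Fin (n + 1) → ℝ), ∀ I, l (ε • hansenVert I) = a0 + ∑ i ∈ I, a i := by
  refine ⟨ε • (a0 • ContinuousLinearMap.proj 0 +
    ∑ i, a i • ContinuousLinearMap.proj (R := ℝ) (φ := fun _ : Fin (n + 1) => ℝ) i.succ),
    fun I => ?_⟩
  have h : ∑ i, a i * hansenVert I i.succ = ∑ i ∈ I, a i := by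
    simp [hansenVert, Finset.sum_ite_mem]
  have h0 : hansenVert I 0 = 1 := rfl
  have hsq : ε * ε = 1 := by rcases hε with rfl | rfl <;> norm_num
  rw [map_smul]
  simp only [smul_apply, add_apply,
    sum_apply, ContinuousLinearMap.proj_apply, smul_eq_mul, h, h0]
  linear_combination (a0 + ∑ i ∈ I, a i) * hsq

theorem mem_toExposed_iff (hε : ε = 1 ∨ ε = -1) {l : StrongDual ℝ (Fin (n + 1) → ℝ)} {a0 : ℝ}
    {a : Fin n → ℝ} (hl : ∀ I, l (ε • hansenVert I) = a0 + ∑ i ∈ I, a i)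
    {I : Finset (Fin n)} (hI : IsStable G I) :
    (ε • hansenVert I ∈ l.toExposed (hansenPolytope G) ↔ MaxAt G a0 a I) ∧
      (-(ε • hansenVert I) ∈ l.toExposed (hansenPolytope G) ↔ MaxAt G (-a0) (-a) I) := by
  have hmax : ∀ r : ℝ, (∀ y ∈ hansenPolytope G, l y ≤ r) ↔
      ∀ J, IsStable G J → a0 + ∑ i ∈ J, a i ≤ r ∧ -(a0 + ∑ i ∈ J, a i) ≤ r := by
    intro r
    refine ⟨fun h J hJ => ?_, fun h => ?_⟩
    · rw [← hl, ← map_neg]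
      exact ⟨h _ (smul_hansenVert_mem hε hJ).1, h _ (smul_hansenVert_mem hε hJ).2⟩
    · rw [hansenPolytope_eq G hε]
      have hconv : Convex ℝ {y | l y ≤ r} := convex_halfSpace_le l.toLinearMap.isLinear r
      refine fun y hy => convexHull_min ?_ hconv hy
      rintro x ⟨J, hJ, rfl | rfl⟩
      · simpa [hl] using (h J hJ).1
      · simpa only [Set.mem_ofPred_eq, map_neg, hl] using (h J hJ).2
  obtain ⟨hm1, hm2⟩ := smul_hansenVert_mem hε hI
  have hneg : ∀ J : Finset (Fin n), -a0 + ∑ i ∈ J, (-a) i = -(a0 + ∑ i ∈ J, a i) := fun J => by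
    simp only [Pi.neg_apply, Finset.sum_neg_distrib]; ring
  constructor
  · simp only [ContinuousLinearMap.toExposed, Set.mem_ofPred_eq, hm1, true_and, hmax, hl, MaxAt]
  · simp only [ContinuousLinearMap.toExposed, Set.mem_ofPred_eq, hm2, true_and, hmax, map_neg, hl,
      MaxAt, hneg, neg_neg]
    exact forall₂_congr fun J _ => and_comm

theorem exists_isExposed_of_pattern (hdisj : Disjoint C S) (hcover : C ∪ S = Finset.univ)
    (hC : G.IsClique (↑C : Set (Fin n))) (hS : IsStable G S) (hε : ε = 1 ∨ ε = -1)
    (f : Fin n → SignType) :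
    ∃ F, IsExposed ℝ (hansenPolytope G) F ∧ ∀ I, IsStable G I →
      (ε • hansenVert I ∈ F ↔ SamePattern G C S f I) ∧
      (-(ε • hansenVert I) ∈ F ↔ OppPattern G C S f I) := by
  obtain ⟨a0, a, ha⟩ := exists_weights_of_pattern hdisj hcover hC hS f
  obtain ⟨l, hl⟩ := exists_dual_of_weights hε a0 a
  refine ⟨l.toExposed (hansenPolytope G), ContinuousLinearMap.toExposed.isExposed,
    fun I hI => ?_⟩
  rw [(mem_toExposed_iff hε hl hI).1, (mem_toExposed_iff hε hl hI).2]
  exact ha I hI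

theorem exists_pattern_of_isExposed (hdisj : Disjoint C S) (hcover : C ∪ S = Finset.univ)
    (hC : G.IsClique (↑C : Set (Fin n))) (hS : IsStable G S) (hε : ε = 1 ∨ ε = -1)
    {F : Set (Fin (n + 1) → ℝ)} (hF : IsExposed ℝ (hansenPolytope G) F) (hne : F.Nonempty)
    (hpos : ∃ B ⊆ C, F ⊆ hFace G ε B) (hneg : ∀ B' ⊆ C, ¬ F ⊆ hFace G (-ε) B') :
    ∃ f : Fin n → SignType, ∀ I, IsStable G I →
      (ε • hansenVert I ∈ F ↔ SamePattern G C S f I) ∧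
      (-(ε • hansenVert I) ∈ F ↔ OppPattern G C S f I) := by
  classical
  obtain ⟨B, hBC, hB⟩ := hpos
  rw [hF.subset_hFace_iff hε] at hB
  obtain ⟨l, hl⟩ := hF hne
  obtain ⟨a0, a, ha⟩ := exists_weights_of_dual ε l
  have hmem : ∀ I, IsStable G I → (ε • hansenVert I ∈ F ↔ MaxAt G a0 a I) ∧
      (-(ε • hansenVert I) ∈ F ↔ MaxAt G (-a0) (-a) I) := by
    intro I hI
    rw [hl]
    exact mem_toExposed_iff hε ha hI
  have hsame : ∀ I, IsStable G I → ε • hansenVert I ∈ F → ∃ c ∈ I, c ∈ B := by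
    intro I hI h
    obtain ⟨c, hc⟩ := Finset.card_eq_one.1 ((hB I hI).1 h)
    have : c ∈ B ∩ I := by simp [hc]
    rw [Finset.mem_inter] at this
    exact ⟨c, this.2, this.1⟩
  have hopp : ∀ I, IsStable G I → -(ε • hansenVert I) ∈ F → ∀ c ∈ I, c ∉ B := by
    intro I hI h c hc hcB
    have : c ∈ B ∩ I := Finset.mem_inter.2 ⟨hcB, hc⟩
    simp [(hB I hI).2 h] at this
  have hsep : ∀ I J, IsStable G I → IsStable G J → ε • hansenVert I ∈ F →
      -(ε • hansenVert J) ∈ F → ∀ c ∈ I, c ∈ C → c ∉ J := by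
    intro I J hI hJ hIF hJF c hcI hcC hcJ
    obtain ⟨b, hbI, hbB⟩ := hsame I hI hIF
    have := hI.eq_of_mem_clique hC hcI hcC hbI (hBC hbB)
    exact hopp J hJ hJF c hcJ (this ▸ hbB)
  have hex : ∃ I, IsStable G I ∧ -(ε • hansenVert I) ∈ F ∧ ∀ c ∈ I, c ∉ C := by
    by_contra! hcon
    refine hneg {c ∈ C | ∃ J, IsStable G J ∧ -(ε • hansenVert J) ∈ F ∧ c ∈ J}
      (Finset.filter_subset _ _) ?_
    rw [hF.subset_hFace_neg_iff hε]
    refine fun I hI => ⟨fun hIF => ?_, fun hIF => ?_⟩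
    · rw [Finset.eq_empty_iff_forall_notMem]
      intro c hc
      simp only [Finset.mem_inter, Finset.mem_filter] at hc
      obtain ⟨⟨hcC, J, hJ, hJF, hcJ⟩, hcI⟩ := hc
      exact hsep I J hI hJ hIF hJF c hcI hcC hcJ
    · obtain ⟨c, hcI, hcC⟩ := hcon I hI hIF
      rw [Finset.card_eq_one]
      refine ⟨c, Finset.eq_singleton_iff_unique_mem.2 ⟨?_, fun b hb => ?_⟩⟩
      · simp only [Finset.mem_inter, Finset.mem_filter]
        exact ⟨⟨hcC, I, hI, hIF, hcI⟩, hcI⟩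
      · simp only [Finset.mem_inter, Finset.mem_filter] at hb
        exact hI.eq_of_mem_clique hC hb.2 hb.1.1 hcI hcC
  obtain ⟨f, hf⟩ := exists_pattern_of_maxAt hdisj hcover hC hS a0 a
    (fun I hI hm => by
      obtain ⟨c, hcI, hcB⟩ := hsame I hI ((hmem I hI).1.2 hm)
      exact ⟨c, hcI, hBC hcB⟩)
    (by
      obtain ⟨I, hI, hIF, hIC⟩ := hex
      exact ⟨I, hI, (hmem I hI).2.1 hIF, hIC⟩)
    (fun I J hI hJ h1 h2 => hsep I J hI hJ ((hmem I hI).1.2 h1) ((hmem J hJ).2.2 h2))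
  refine ⟨f, fun I hI => ?_⟩
  rw [(hmem I hI).1, (hmem I hI).2]
  exact hf I hI

end Geometry

/-- For a split graph `G = C ∪ S` on `d − 1` vertices (`d = n + 1`) and a sign `ε`,
the number of nonempty (exposed) faces of `H(G)` contained in some type-(1)-facet
`[ε, B]` (`B ⊆ C`) but in no type-(1)-facet `[−ε, B']` (`B' ⊆ C`) equals `3^{d−1}`.
In particular the numbers of positive and of negative faces agree and equal `3^{d−1}`. -/
theorem hansen_split_signed_face_count {n : ℕ} (G : SimpleGraph (Fin n))
    (C S : Finset (Fin n)) (hdisj : Disjoint C S) (hcover : C ∪ S = Finset.univ)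
    (hC : G.IsClique (↑C : Set (Fin n))) (hS : IsStable G S)
    (ε : ℝ) (hε : ε = 1 ∨ ε = -1) :
    {F : Set (Fin (n + 1) → ℝ) | IsExposed ℝ (hansenPolytope G) F ∧ F.Nonempty ∧
      (∃ B ⊆ C, F ⊆ hFace G ε B) ∧ (∀ B' ⊆ C, ¬ F ⊆ hFace G (-ε) B')}.ncard = 3 ^ n := by
  choose Φ hΦ hpat using exists_isExposed_of_pattern hdisj hcover hC hS hε
  have hinj : Function.Injective Φ := fun f g hfg =>
    eq_of_pattern_iff hdisj hcover hS
      (fun I hI => by rw [← (hpat f I hI).1, ← (hpat g I hI).1, hfg])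
      (fun I hI => by rw [← (hpat f I hI).2, ← (hpat g I hI).2, hfg])
  have hset : {F : Set (Fin (n + 1) → ℝ) | IsExposed ℝ (hansenPolytope G) F ∧ F.Nonempty ∧
      (∃ B ⊆ C, F ⊆ hFace G ε B) ∧ (∀ B' ⊆ C, ¬ F ⊆ hFace G (-ε) B')} = Set.range Φ := by
    ext F
    constructor
    · rintro ⟨hF, hne, hpos, hneg⟩
      obtain ⟨f, hf⟩ := exists_pattern_of_isExposed hdisj hcover hC hS hε hF hne hpos hneg
      refine ⟨f, (hΦ f).eq_of_hansenVert hε hF fun I hI => ?_⟩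
      rw [(hpat f I hI).1, (hpat f I hI).2, (hf I hI).1, (hf I hI).2]
      exact ⟨Iff.rfl, Iff.rfl⟩
    · rintro ⟨f, rfl⟩
      exact ⟨hΦ f, subset_hFace_of_pattern hdisj hC hS hε (hΦ f) (hpat f)⟩
  rw [hset, ← Set.image_univ, Set.ncard_image_of_injective _ hinj, Set.ncard_univ,
    Nat.card_eq_fintype_card, Fintype.card_fun, Fintype.card_fin]
  rfl
end

section
/- Let G be a split graph on d−1 vertices with vertex partition into a clique C and a stable set S. Then p_G(C,S) is divisible by 16, so s(H(G)) = 3^d + 16·ℓ for some natural number ℓ; moreover ℓ = 0 (equivalently p_G(C,S) = 0) if and only if G is a threshold graph. -/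
/-- The number of nonempty (exposed) faces of a polytope `P ⊆ ℝ^d`, including `P` itself. -/
noncomputable def numFaces {d : ℕ} (P : Set (Fin d → ℝ)) : ℕ :=
  {F : Set (Fin d → ℝ) | IsExposed ℝ P F ∧ F.Nonempty}.ncard

/-- `p_G(C,S)`: the number of partitions `(C⁺, C⁻, C⁰, S⁺, S⁻, S⁰)` of `(C, S)` —
encoded as quadruples `(C⁺, C⁻, S⁺, S⁻)` of disjoint subsets, with `C⁰, S⁰` the
complements — that are nontrivial (`C⁺ ∪ C⁻ ≠ ∅` or `S⁺ ∪ S⁻ ≠ ∅`) and satisfy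
(A) every element of `C⁺ ∪ C⁻` has a neighbor in `S⁺ ∪ S⁻`, and
(B) every element of `S⁺ ∪ S⁻` has a non-neighbor in `C⁺ ∪ C⁻`. -/
noncomputable def pG {n : ℕ} (G : SimpleGraph (Fin n)) (C S : Finset (Fin n)) : ℕ :=
  Set.ncard {q : Finset (Fin n) × Finset (Fin n) × Finset (Fin n) × Finset (Fin n) |
    q.1 ⊆ C ∧ q.2.1 ⊆ C ∧ Disjoint q.1 q.2.1 ∧
    q.2.2.1 ⊆ S ∧ q.2.2.2 ⊆ S ∧ Disjoint q.2.2.1 q.2.2.2 ∧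
    ((q.1 ∪ q.2.1).Nonempty ∨ (q.2.2.1 ∪ q.2.2.2).Nonempty) ∧
    (∀ c ∈ q.1 ∪ q.2.1, ∃ s ∈ q.2.2.1 ∪ q.2.2.2, G.Adj c s) ∧
    (∀ s ∈ q.2.2.1 ∪ q.2.2.2, ∃ c ∈ q.1 ∪ q.2.1, ¬ G.Adj c s)}


/-- Threshold graphs: obtainable from the empty graph by repeatedly adding an isolated
vertex or a dominating vertex (up to isomorphism of labelled graphs on `Fin n`). -/
inductive IsThresholdGraph : {n : ℕ} → SimpleGraph (Fin n) → Prop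
  | empty : IsThresholdGraph (⊥ : SimpleGraph (Fin 0))
  | addIsolated {n : ℕ} {G : SimpleGraph (Fin n)} :
      IsThresholdGraph G → IsThresholdGraph (G.map Fin.castSuccEmb)
  | addDominating {n : ℕ} {G : SimpleGraph (Fin n)} :
      IsThresholdGraph G → IsThresholdGraph ((Gᶜ.map Fin.castSuccEmb)ᶜ)
  | iso {n : ℕ} {G G' : SimpleGraph (Fin n)} :
      IsThresholdGraph G → (G ≃g G') → IsThresholdGraph G'

/-- The sign `1` for `true` and `-1` for `false`. -/
def boolSign : Bool → SignType := fun ε => if ε then 1 else -1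

/-- The vertex `± (e_0 + ∑_{i ∈ I} e_i)` of the Hansen polytope with the given sign. -/
noncomputable def signedVert {n : ℕ} (q : Bool × Finset (Fin n)) : Fin (n + 1) → ℝ :=
  (boolSign q.1 : ℝ) • hansenVert q.2

/-- The value at a signed vertex of the functional with constant coefficient `a` and weights `w`. -/
noncomputable def vertVal {n : ℕ} (a : ℝ) (w : Fin n → ℝ) (q : Bool × Finset (Fin n)) : ℝ :=
  (boolSign q.1 : ℝ) * (a + ∑ i ∈ q.2, w i)

/-- The signed vertices maximizing the functional with coefficients `a`, `w`. -/
def optSet {n : ℕ} (G : SimpleGraph (Fin n)) (a : ℝ) (w : Fin n → ℝ) :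
    Set (Bool × Finset (Fin n)) :=
  {q | IsStable G q.2 ∧ ∀ r : Bool × Finset (Fin n), IsStable G r.2 → vertVal a w r ≤ vertVal a w q}

theorem hansenPolytope_eq_s15 {n : ℕ} (G : SimpleGraph (Fin n)) :
    hansenPolytope G = convexHull ℝ (signedVert '' {q | IsStable G q.2}) := by
  unfold hansenPolytope
  congr 1
  ext x
  constructor
  · rintro ⟨I, hI, rfl | rfl⟩
    · exact ⟨(true, I), hI, by simp [signedVert, boolSign]⟩
    · exact ⟨(false, I), hI, by simp [signedVert, boolSign]⟩
  · rintro ⟨⟨ε, I⟩, hI, rfl⟩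
    refine ⟨I, hI, ?_⟩
    cases ε <;> simp [signedVert, boolSign]

theorem exposed_face_eq_of_inter {E : Type*} [AddCommGroup E] [Module ℝ E] [TopologicalSpace E]
    [T2Space E] [IsTopologicalAddGroup E] [ContinuousSMul ℝ E] [LocallyConvexSpace ℝ E]
    {V F : Set E} (hV : V.Finite) (hF : IsExposed ℝ (convexHull ℝ V) F) :
    F = closure (convexHull ℝ (F ∩ V)) := by
  have hc : IsCompact F := hF.isCompact (hV.isCompact_convexHull (𝕜 := ℝ))
  have hconv : Convex ℝ F := hF.convex (convex_convexHull ℝ V)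
  apply subset_antisymm
  · conv_lhs => rw [← closure_convexHull_extremePoints hc hconv]
    apply closure_mono
    apply convexHull_mono
    rw [hF.isExtreme.extremePoints_eq]
    exact Set.inter_subset_inter_right _ extremePoints_convexHull_subset
  · exact closure_minimal (convexHull_min Set.inter_subset_left hconv) hc.isClosed

theorem functional_hansenVert {n : ℕ} (l : StrongDual ℝ (Fin (n + 1) → ℝ))
    (q : Bool × Finset (Fin n)) :
    l (signedVert q) =
      vertVal (l (Pi.single 0 1)) (fun i => l (Pi.single i.succ 1)) q := by
  have h : hansenVert q.2 = Pi.single 0 1 + ∑ i ∈ q.2, Pi.single (i.succ : Fin (n + 1)) (1 : ℝ) := by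
    funext j
    refine Fin.cases ?_ (fun k => ?_) j
    · simp [hansenVert, Finset.sum_apply]
    · simp [hansenVert, Finset.sum_apply, Pi.single_apply]
  simp [signedVert, vertVal, h, map_sum, mul_add]

theorem exists_functional {n : ℕ} (a : ℝ) (w : Fin n → ℝ) :
    ∃ l : StrongDual ℝ (Fin (n + 1) → ℝ),
      l (Pi.single 0 1) = a ∧ ∀ i : Fin n, l (Pi.single i.succ 1) = w i := by
  refine ⟨∑ j : Fin (n + 1), (Fin.cons a w : Fin (n + 1) → ℝ) j •
    ContinuousLinearMap.proj (R := ℝ) (φ := fun _ : Fin (n + 1) => ℝ) j, ?_, fun i => ?_⟩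
  · simp [Pi.single_apply]
  · simp [Pi.single_apply]

theorem toExposed_preimage {n : ℕ} (G : SimpleGraph (Fin n))
    (l : StrongDual ℝ (Fin (n + 1) → ℝ)) :
    {q | IsStable G q.2 ∧ signedVert q ∈ l.toExposed (hansenPolytope G)} =
      optSet G (l (Pi.single 0 1)) (fun i => l (Pi.single i.succ 1)) := by
  ext q
  simp only [Set.mem_ofPred_eq, optSet, ContinuousLinearMap.toExposed, ← functional_hansenVert]
  refine and_congr_right fun hq => ⟨fun h r hr => h.2 _ ?_, fun h => ⟨?_, fun y hy => ?_⟩⟩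
  · rw [hansenPolytope_eq_s15]
    exact subset_convexHull _ _ ⟨r, hr, rfl⟩
  · rw [hansenPolytope_eq_s15]
    exact subset_convexHull _ _ ⟨q, hq, rfl⟩
  · rw [hansenPolytope_eq_s15] at hy
    have hsub : convexHull ℝ (signedVert '' {q | IsStable G q.2}) ⊆
        {y | l y ≤ l (signedVert q)} := by
      refine convexHull_min ?_ (convex_halfSpace_le l.toLinearMap.isLinear _)
      rintro _ ⟨r, hr, rfl⟩
      exact h r hr
    exact hsub hy

theorem numFaces_hansenPolytope {n : ℕ} (G : SimpleGraph (Fin n)) :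
    numFaces (hansenPolytope G) =
      (Set.range fun p : ℝ × (Fin n → ℝ) => optSet G p.1 p.2).ncard := by
  have hfin : (signedVert '' {q : Bool × Finset (Fin n) | IsStable G q.2}).Finite :=
    (Set.toFinite _).image _
  have himg : (fun F : Set (Fin (n + 1) → ℝ) => {q | IsStable G q.2 ∧ signedVert q ∈ F}) ''
      {F | IsExposed ℝ (hansenPolytope G) F ∧ F.Nonempty} =
      Set.range fun p : ℝ × (Fin n → ℝ) => optSet G p.1 p.2 := by
    ext X
    constructor
    · rintro ⟨F, ⟨hF, hne⟩, rfl⟩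
      obtain ⟨l, hl⟩ := hF hne
      refine ⟨(l (Pi.single 0 1), fun i => l (Pi.single i.succ 1)), ?_⟩
      have := toExposed_preimage G l
      simp only [ContinuousLinearMap.toExposed, ← hl] at this
      exact this.symm
    · rintro ⟨⟨a, w⟩, rfl⟩
      obtain ⟨l, rfl, hw⟩ := exists_functional a w
      obtain rfl : (fun i => l (Pi.single i.succ 1)) = w := funext hw
      refine ⟨l.toExposed (hansenPolytope G),
        ⟨ContinuousLinearMap.toExposed.isExposed, ?_⟩, toExposed_preimage G l⟩
      have hc : IsCompact (hansenPolytope G) := by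
        rw [hansenPolytope_eq_s15]; exact hfin.isCompact_convexHull (𝕜 := ℝ)
      have hn : (hansenPolytope G).Nonempty := by
        rw [hansenPolytope_eq_s15]
        exact ⟨_, subset_convexHull _ _ ⟨(true, ∅), fun _ h => by simp at h, rfl⟩⟩
      obtain ⟨x, hx, hmax⟩ := hc.exists_isMaxOn hn l.continuous.continuousOn
      exact ⟨x, hx, hmax⟩
  rw [numFaces, ← himg, Set.InjOn.ncard_image]
  rintro F ⟨hF, -⟩ F' ⟨hF', -⟩ h
  rw [hansenPolytope_eq_s15] at hF hF'
  rw [exposed_face_eq_of_inter hfin hF, exposed_face_eq_of_inter hfin hF']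
  congr 2
  ext x
  constructor
  · rintro ⟨hx, q, hq, rfl⟩
    exact ⟨((Set.ext_iff.1 h q).1 ⟨hq, hx⟩).2, q, hq, rfl⟩
  · rintro ⟨hx, q, hq, rfl⟩
    exact ⟨((Set.ext_iff.1 h q).2 ⟨hq, hx⟩).2, q, hq, rfl⟩

theorem boolSign_ne_zero (ε : Bool) : boolSign ε ≠ 0 := by cases ε <;> decide

/-- The sign vectors whose support on `C` satisfies condition (A). -/
def NbrCond {n : ℕ} (G : SimpleGraph (Fin n)) (C S : Finset (Fin n)) (θ : Fin n → SignType) :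
    Prop :=
  ∀ c ∈ C, θ c ≠ 0 → ∃ s ∈ S, G.Adj c s ∧ θ s ≠ 0

/-- The sign vectors whose support on `S` satisfies condition (B). -/
def NonNbrCond {n : ℕ} (G : SimpleGraph (Fin n)) (C S : Finset (Fin n)) (θ : Fin n → SignType) :
    Prop :=
  ∀ s ∈ S, θ s ≠ 0 → ∃ c ∈ C, ¬ G.Adj c s ∧ θ c ≠ 0

theorem nbrCond_or_nonNbrCond {n : ℕ} (G : SimpleGraph (Fin n)) (C S : Finset (Fin n))
    (θ : Fin n → SignType) : NbrCond G C S θ ∨ NonNbrCond G C S θ := by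
  by_contra! h
  simp only [NbrCond, NonNbrCond] at h
  push Not at h
  grind

/-- Codes for the faces of the Hansen polytope. -/
def faceCodes {n : ℕ} (G : SimpleGraph (Fin n)) (C S : Finset (Fin n)) :
    Set ((Bool × Bool) × (Fin n → SignType)) :=
  {κ | (κ.1 = (true, true) → NbrCond G C S κ.2) ∧
    (κ.1 = (false, false) → NonNbrCond G C S κ.2 ∧ κ.2 ≠ 0)}

theorem eq_zero_of_nonNbrCond {n : ℕ} {G : SimpleGraph (Fin n)} {C S : Finset (Fin n)}
    (hcover : C ∪ S = Finset.univ) {θ : Fin n → SignType} (h : NonNbrCond G C S θ)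
    (h0 : ∀ c ∈ C, θ c = 0) : θ = 0 := by
  funext i
  have hi : i ∈ C ∪ S := hcover ▸ Finset.mem_univ i
  rcases Finset.mem_union.1 hi with hi | hi
  · exact h0 i hi
  · by_contra hne
    obtain ⟨c, hc, -, h1⟩ := h i hi hne
    exact h1 (h0 c hc)

theorem ncard_faceCodes {n : ℕ} (G : SimpleGraph (Fin n)) (C S : Finset (Fin n)) :
    (faceCodes G C S).ncard =
      3 ^ (n + 1) + {θ | NbrCond G C S θ ∧ NonNbrCond G C S θ ∧ θ ≠ 0}.ncard := by
  have huniv : (Set.univ : Set (Fin n → SignType)).ncard = 3 ^ n := by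
    rw [Set.ncard_univ, Nat.card_eq_fintype_card, Fintype.card_fun]
    simp; rfl
  have hinj (b : Bool × Bool) : Function.Injective (fun θ : Fin n → SignType => (b, θ)) :=
    fun _ _ h => (Prod.mk.inj h).2
  have hsplit : faceCodes G C S =
      ((fun θ => ((true, false), θ)) '' Set.univ ∪ (fun θ => ((false, true), θ)) '' Set.univ) ∪
      ((fun θ => ((true, true), θ)) '' {θ | NbrCond G C S θ} ∪
        (fun θ => ((false, false), θ)) '' {θ | NonNbrCond G C S θ ∧ θ ≠ 0}) := by
    ext ⟨⟨b, b'⟩, θ⟩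
    cases b <;> cases b' <;> simp [faceCodes]
  have hdisj (b b' : Bool × Bool) (h : b ≠ b') (X Y : Set (Fin n → SignType)) :
      Disjoint ((fun θ => (b, θ)) '' X) ((fun θ => (b', θ)) '' Y) := by
    rw [Set.disjoint_left]
    rintro _ ⟨θ, -, rfl⟩ ⟨θ', -, h'⟩
    exact h (Prod.mk.inj h').1.symm
  rw [hsplit, Set.ncard_union_eq, Set.ncard_union_eq, Set.ncard_union_eq,
    Set.ncard_image_of_injective _ (hinj _), Set.ncard_image_of_injective _ (hinj _),
    Set.ncard_image_of_injective _ (hinj _), Set.ncard_image_of_injective _ (hinj _), huniv]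
  · have h1 := Set.ncard_union_add_ncard_inter {θ | NbrCond G C S θ}
      {θ | NonNbrCond G C S θ ∧ θ ≠ 0}
    have h2 : {θ | NbrCond G C S θ} ∪ {θ | NonNbrCond G C S θ ∧ θ ≠ 0} = Set.univ := by
      ext θ
      have := nbrCond_or_nonNbrCond G C S θ
      by_cases h : θ = 0
      · subst h; simp [NbrCond]
      · simpa [h]
    have h3 : {θ | NbrCond G C S θ} ∩ {θ | NonNbrCond G C S θ ∧ θ ≠ 0} =
        {θ | NbrCond G C S θ ∧ NonNbrCond G C S θ ∧ θ ≠ 0} := rfl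
    rw [h2, h3, huniv] at h1
    rw [← h1]; ring
  all_goals try simp only [Set.disjoint_union_left, Set.disjoint_union_right]
  all_goals try refine ⟨⟨?_, ?_⟩, ?_, ?_⟩
  all_goals exact hdisj _ _ (by decide) _ _

theorem sign_support_card_ge_four {n : ℕ} {G : SimpleGraph (Fin n)} {C S : Finset (Fin n)}
    (hdisj : Disjoint C S) (hcover : C ∪ S = Finset.univ) {U : Finset (Fin n)}
    (hA : ∀ c ∈ C, c ∈ U → ∃ s ∈ S, G.Adj c s ∧ s ∈ U)
    (hB : ∀ s ∈ S, s ∈ U → ∃ c ∈ C, ¬ G.Adj c s ∧ c ∈ U) (hU : U.Nonempty) : 4 ≤ U.card := by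
  have hd := Finset.disjoint_left.1 hdisj
  obtain ⟨c, hcC, hcU⟩ : ∃ c ∈ C, c ∈ U := by
    obtain ⟨i, hi⟩ := hU
    rcases Finset.mem_union.1 (hcover ▸ Finset.mem_univ i : i ∈ C ∪ S) with h | h
    · exact ⟨i, h, hi⟩
    · obtain ⟨c, h1, -, h2⟩ := hB i h hi
      exact ⟨c, h1, h2⟩
  obtain ⟨s, hsS, hcs, hsU⟩ := hA c hcC hcU
  obtain ⟨c', hcC', hcs', hcU'⟩ := hB s hsS hsU
  obtain ⟨s', hsS', hcs'', hsU'⟩ := hA c' hcC' hcU'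
  have hsub : ({c, c', s, s'} : Finset (Fin n)) ⊆ U := by
    intro x hx
    simp only [Finset.mem_insert, Finset.mem_singleton] at hx
    rcases hx with rfl | rfl | rfl | rfl <;> assumption
  refine le_trans (le_of_eq ?_) (Finset.card_le_card hsub)
  have h1 : c ≠ c' := fun h => hcs' (h ▸ hcs)
  have h2 : s ≠ s' := fun h => hcs' (h ▸ hcs'')
  have h3 : c ≠ s := fun h => hd hcC (h ▸ hsS)
  have h4 : c ≠ s' := fun h => hd hcC (h ▸ hsS')
  have h5 : c' ≠ s := fun h => hd hcC' (h ▸ hsS)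
  have h6 : c' ≠ s' := fun h => hd hcC' (h ▸ hsS')
  simp [*]

theorem card_sign_support_eq {n : ℕ} (U : Finset (Fin n)) :
    (Finset.univ.filter fun θ : Fin n → SignType =>
      (Finset.univ.filter fun i => θ i ≠ 0) = U).card = 2 ^ U.card := by
  have : (Finset.univ.filter fun θ : Fin n → SignType =>
      (Finset.univ.filter fun i => θ i ≠ 0) = U) =
      Fintype.piFinset fun i => if i ∈ U then ({1, -1} : Finset SignType) else {0} := by
    ext θ
    simp only [Finset.mem_filter, Finset.mem_univ, true_and, Fintype.mem_piFinset,
      Finset.ext_iff (s₂ := U)]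
    refine forall_congr' fun i => ?_
    have : ∀ x : SignType, x ≠ 0 ↔ x = 1 ∨ x = -1 := by decide
    by_cases hi : i ∈ U
    · simp [hi, this]
    · simp [hi]
  rw [this, Fintype.card_piFinset]
  have h2 : ∀ i, (if i ∈ U then ({1, -1} : Finset SignType) else {0}).card =
      if i ∈ U then 2 else 1 := by
    intro i; split_ifs <;> rfl
  simp [h2]

theorem sixteen_dvd_ncard {n : ℕ} (G : SimpleGraph (Fin n)) (C S : Finset (Fin n))
    (hdisj : Disjoint C S) (hcover : C ∪ S = Finset.univ) :
    16 ∣ {θ | NbrCond G C S θ ∧ NonNbrCond G C S θ ∧ θ ≠ 0}.ncard := by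
  classical
  have : {θ | NbrCond G C S θ ∧ NonNbrCond G C S θ ∧ θ ≠ 0} =
      ((Finset.univ.filter fun θ => NbrCond G C S θ ∧ NonNbrCond G C S θ ∧ θ ≠ 0 :
        Finset (Fin n → SignType)) : Set (Fin n → SignType)) := by
    ext; simp
  rw [this, Set.ncard_coe_finset, Finset.card_eq_sum_card_fiberwise
    (f := fun θ : Fin n → SignType => Finset.univ.filter fun i => θ i ≠ 0) (t := Finset.univ)
    (fun _ _ => by simp)]
  refine Finset.dvd_sum fun U _ => ?_
  by_cases h : (∀ c ∈ C, c ∈ U → ∃ s ∈ S, G.Adj c s ∧ s ∈ U) ∧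
      (∀ s ∈ S, s ∈ U → ∃ c ∈ C, ¬ G.Adj c s ∧ c ∈ U) ∧ U.Nonempty
  · have hcard := sign_support_card_ge_four hdisj hcover h.1 h.2.1 h.2.2
    have heq : (Finset.univ.filter fun θ : Fin n → SignType =>
        NbrCond G C S θ ∧ NonNbrCond G C S θ ∧ θ ≠ 0).filter
          (fun θ => (Finset.univ.filter fun i => θ i ≠ 0) = U) =
        Finset.univ.filter fun θ : Fin n → SignType =>
          (Finset.univ.filter fun i => θ i ≠ 0) = U := by
      ext θ
      simp only [Finset.mem_filter, Finset.mem_univ, true_and, and_iff_right_iff_imp]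
      rintro rfl
      simp only [Finset.mem_filter, Finset.mem_univ, true_and] at h
      refine ⟨h.1, h.2.1, ?_⟩
      rintro rfl
      simp at h
    rw [heq, card_sign_support_eq]
    exact pow_dvd_pow 2 hcard
  · convert dvd_zero 16
    rw [Finset.card_eq_zero, Finset.filter_eq_empty_iff]
    rintro θ hθ rfl
    simp only [Finset.mem_filter, Finset.mem_univ, true_and] at hθ h
    refine h ⟨hθ.1, hθ.2.1, ?_⟩
    obtain ⟨i, hi⟩ := Function.ne_iff.1 hθ.2.2
    exact ⟨i, by simpa using hi⟩

theorem pG_eq_ncard {n : ℕ} (G : SimpleGraph (Fin n)) (C S : Finset (Fin n))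
    (hdisj : Disjoint C S) (hcover : C ∪ S = Finset.univ) :
    pG G C S = {θ | NbrCond G C S θ ∧ NonNbrCond G C S θ ∧ θ ≠ 0}.ncard := by
  have hd := Finset.disjoint_left.1 hdisj
  have hcov (i : Fin n) : i ∈ C ∨ i ∈ S :=
    Finset.mem_union.1 (hcover ▸ Finset.mem_univ i : i ∈ C ∪ S)
  have htri : ∀ x : SignType, x ≠ 0 ↔ x = 1 ∨ x = -1 := by decide
  let f : (Fin n → SignType) → Finset (Fin n) × Finset (Fin n) × Finset (Fin n) × Finset (Fin n) :=
    fun θ => (C.filter fun i => θ i = 1, C.filter fun i => θ i = -1,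
      S.filter fun i => θ i = 1, S.filter fun i => θ i = -1)
  have hinj : Function.Injective f := by
    intro θ θ' h
    simp only [f, Prod.mk.injEq, Finset.ext_iff, Finset.mem_filter] at h
    obtain ⟨h1, h2, h3, h4⟩ := h
    have hext : ∀ x y : SignType, (x = 1 ↔ y = 1) → (x = -1 ↔ y = -1) → x = y := by decide
    funext i
    rcases hcov i with hi | hi
    · exact hext _ _ (by simpa [hi] using h1 i) (by simpa [hi] using h2 i)
    · exact hext _ _ (by simpa [hi] using h3 i) (by simpa [hi] using h4 i)
  rw [← Set.ncard_image_of_injective _ hinj, pG]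
  congr 1
  ext ⟨P, N, P', N'⟩
  have hmem (θ : Fin n → SignType) (D : Finset (Fin n)) (i : Fin n) :
      i ∈ (D.filter fun i => θ i = 1) ∪ (D.filter fun i => θ i = -1) ↔ i ∈ D ∧ θ i ≠ 0 := by
    simp only [Finset.mem_union, Finset.mem_filter, htri]; tauto
  constructor
  · rintro ⟨hP, hN, hPN, hP', hN', hPN', hne, hA, hB⟩
    simp only at hP hN hPN hP' hN' hPN' hne hA hB
    have hd1 := Finset.disjoint_left.1 hPN
    have hd2 := Finset.disjoint_left.1 hPN'
    let θ : Fin n → SignType := fun i => if i ∈ P ∪ P' then 1 else if i ∈ N ∪ N' then -1 else 0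
    have hf : f θ = (P, N, P', N') := by
      have h1 (i) : θ i = 1 ↔ i ∈ P ∪ P' := by
        simp only [θ]
        split_ifs <;> simp_all
      have h2 (i) : θ i = -1 ↔ i ∉ P ∪ P' ∧ i ∈ N ∪ N' := by
        simp only [θ]
        split_ifs <;> simp_all
      simp only [f, Prod.mk.injEq, Finset.ext_iff, Finset.mem_filter, h1, h2, Finset.mem_union]
      refine ⟨fun i => ⟨fun ⟨hc, h⟩ => h.resolve_right fun h => hd hc (hP' h),
          fun h => ⟨hP h, Or.inl h⟩⟩,
        fun i => ⟨fun ⟨hc, _, h⟩ => h.resolve_right fun h => hd hc (hN' h),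
          fun h => ⟨hN h, fun h' => h'.elim (fun p => hd1 p h) (fun p => hd (hN h) (hP' p)),
            Or.inl h⟩⟩,
        fun i => ⟨fun ⟨hs, h⟩ => h.resolve_left fun h => hd (hP h) hs,
          fun h => ⟨hP' h, Or.inr h⟩⟩,
        fun i => ⟨fun ⟨hs, _, h⟩ => h.resolve_left fun h => hd (hN h) hs,
          fun h => ⟨hN' h, fun h' => h'.elim (fun p => hd (hP p) (hN' h)) (fun p => hd2 p h),
            Or.inr h⟩⟩⟩
    clear_value θ
    have hf' := hf
    simp only [f, Prod.mk.injEq] at hf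
    obtain ⟨rfl, rfl, rfl, rfl⟩ := hf
    refine ⟨θ, ⟨?_, ?_, ?_⟩, hf'⟩
    · intro c hc h0
      obtain ⟨s, hs, h⟩ := hA c ((hmem _ _ _).2 ⟨hc, h0⟩)
      have := (hmem _ _ _).1 hs
      exact ⟨s, this.1, h, this.2⟩
    · intro c hc h0
      obtain ⟨s, hs, h⟩ := hB c ((hmem _ _ _).2 ⟨hc, h0⟩)
      have := (hmem _ _ _).1 hs
      exact ⟨s, this.1, h, this.2⟩
    · intro h
      rcases hne with ⟨i, hi⟩ | ⟨i, hi⟩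
      · exact ((hmem _ _ _).1 hi).2 (congrFun h i)
      · exact ((hmem _ _ _).1 hi).2 (congrFun h i)
  · rintro ⟨θ, ⟨hA, hB, hne⟩, h⟩
    simp only [f, Prod.mk.injEq] at h
    obtain ⟨rfl, rfl, rfl, rfl⟩ := h
    have hdj (D : Finset (Fin n)) :
        Disjoint (D.filter fun i => θ i = 1) (D.filter fun i => θ i = -1) := by
      rw [Finset.disjoint_filter]
      intro i _ h1 h2
      rw [h1] at h2
      exact absurd h2 (by decide)
    refine ⟨Finset.filter_subset _ _, Finset.filter_subset _ _, hdj _, Finset.filter_subset _ _,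
      Finset.filter_subset _ _, hdj _, ?_, ?_, ?_⟩
    · obtain ⟨i, hi⟩ := Function.ne_iff.1 hne
      rcases hcov i with h | h
      · exact Or.inl ⟨i, (hmem _ _ _).2 ⟨h, hi⟩⟩
      · exact Or.inr ⟨i, (hmem _ _ _).2 ⟨h, hi⟩⟩
    · intro c hc
      have hc := (hmem _ _ _).1 hc
      obtain ⟨s, h1, h2, h3⟩ := hA c hc.1 hc.2
      exact ⟨s, (hmem _ _ _).2 ⟨h1, h3⟩, h2⟩
    · intro s hs
      have hs := (hmem _ _ _).1 hs
      obtain ⟨c, h1, h2, h3⟩ := hB s hs.1 hs.2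
      exact ⟨c, (hmem _ _ _).2 ⟨h1, h3⟩, h2⟩

/-- A value and a membership proposition are compatible if members have nonnegative values and
non-members have nonpositive values. -/
def SignCompat {α : Type*} [Zero α] [LE α] (x : α) (p : Prop) : Prop :=
  (p → 0 ≤ x) ∧ (¬ p → x ≤ 0)

/-- The sum of the positive parts of the weights over `T`. -/
noncomputable def posSum {n : ℕ} (W : Fin n → ℝ) (T : Finset (Fin n)) : ℝ :=
  ∑ s ∈ T, max (W s) 0

theorem posSum_nonneg {n : ℕ} (W : Fin n → ℝ) (T : Finset (Fin n)) : 0 ≤ posSum W T :=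
  Finset.sum_nonneg fun _ _ => le_max_right _ _

theorem posSum_eq_zero_iff {n : ℕ} (W : Fin n → ℝ) (T : Finset (Fin n)) :
    posSum W T = 0 ↔ ∀ s ∈ T, W s ≤ 0 := by
  rw [posSum, Finset.sum_eq_zero_iff_of_nonneg fun _ _ => le_max_right _ _]
  simp

/-- The total failure of compatibility between the weights on `T` and the set `I`. -/
noncomputable def defect {n : ℕ} (W : Fin n → ℝ) (T I : Finset (Fin n)) : ℝ :=
  ∑ s ∈ T, (max (W s) 0 - if s ∈ I then W s else 0)

theorem defect_term_nonneg {n : ℕ} (W : Fin n → ℝ) (I : Finset (Fin n)) (s : Fin n) :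
    0 ≤ max (W s) 0 - if s ∈ I then W s else 0 := by
  split_ifs <;> simp

theorem defect_nonneg {n : ℕ} (W : Fin n → ℝ) (T I : Finset (Fin n)) : 0 ≤ defect W T I :=
  Finset.sum_nonneg fun _ _ => defect_term_nonneg _ _ _

theorem defect_eq_zero_iff {n : ℕ} (W : Fin n → ℝ) (T I : Finset (Fin n)) :
    defect W T I = 0 ↔ ∀ s ∈ T, SignCompat (W s) (s ∈ I) := by
  rw [defect, Finset.sum_eq_zero_iff_of_nonneg fun _ _ => defect_term_nonneg _ _ _]
  refine forall₂_congr fun s _ => ?_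
  by_cases h : s ∈ I <;> simp [SignCompat, h, sub_eq_zero]

theorem sum_add_defect {n : ℕ} (W : Fin n → ℝ) {T I : Finset (Fin n)} (h : I ⊆ T) :
    ∑ i ∈ I, W i + defect W T I = posSum W T := by
  rw [defect, Finset.sum_sub_distrib, Finset.sum_ite_mem, Finset.inter_eq_right.2 h, posSum]
  ring

theorem isStable_of_subset {n : ℕ} {G : SimpleGraph (Fin n)} {S T : Finset (Fin n)}
    (hS : IsStable G S) (h : T ⊆ S) : IsStable G T :=
  fun _ ha _ hb => hS (h ha) (h hb)

theorem isStable_insert {n : ℕ} {G : SimpleGraph (Fin n)} {T : Finset (Fin n)} {c : Fin n}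
    (hT : IsStable G T) (h : ∀ s ∈ T, ¬ G.Adj c s) : IsStable G (insert c T) := by
  intro a ha b hb
  rcases Finset.mem_insert.1 ha with rfl | ha' <;> rcases Finset.mem_insert.1 hb with rfl | hb'
  · exact G.irrefl
  · exact h b hb'
  · exact fun hab => h a ha' hab.symm
  · exact hT ha' hb'

section

variable {n : ℕ} {G : SimpleGraph (Fin n)} {C S : Finset (Fin n)}

theorem subset_of_disjoint (hcover : C ∪ S = Finset.univ) {I : Finset (Fin n)}
    (h : Disjoint I C) : I ⊆ S := fun i hi =>
  (Finset.mem_union.1 (hcover ▸ Finset.mem_univ i : i ∈ C ∪ S)).resolve_left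
    (Finset.disjoint_left.1 h hi)

/-- The stable set `I` satisfies the tightness conditions for the weights `W` with slack `x`. -/
def IsTight (G : SimpleGraph (Fin n)) [DecidableRel G.Adj] (C S : Finset (Fin n))
    (W : Fin n → ℝ) (x : ℝ) (I : Finset (Fin n)) : Prop :=
  (Disjoint I C ∧ x = 0 ∧ ∀ s ∈ S, SignCompat (W s) (s ∈ I)) ∨
    ∃ c ∈ C, c ∈ I ∧ W c = x + posSum W {s ∈ S | G.Adj c s} ∧
      ∀ s ∈ S, ¬ G.Adj c s → SignCompat (W s) (s ∈ I)

theorem sum_add_defect_of_mem (hcover : C ∪ S = Finset.univ) (hdisj : Disjoint C S)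
    (hC : G.IsClique (↑C : Set (Fin n))) [DecidableRel G.Adj] (W : Fin n → ℝ)
    {I : Finset (Fin n)} (hI : IsStable G I) {c : Fin n} (hc : c ∈ C) (hcI : c ∈ I) :
    ∑ i ∈ I, W i + posSum W {s ∈ S | G.Adj c s} + defect W {s ∈ S | ¬ G.Adj c s} I =
      W c + posSum W S := by
  have hcS : c ∉ S := Finset.disjoint_left.1 hdisj hc
  have hsub : I.erase c ⊆ ({s ∈ S | ¬ G.Adj c s} : Finset (Fin n)) := by
    intro i hi
    obtain ⟨hne, hiI⟩ := Finset.mem_erase.1 hi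
    refine Finset.mem_filter.2 ⟨?_, hI hcI hiI⟩
    refine (Finset.mem_union.1 (hcover ▸ Finset.mem_univ i : i ∈ C ∪ S)).resolve_left fun h => ?_
    exact hI hcI hiI (hC hc h hne.symm)
  have h1 := sum_add_defect W hsub
  have h2 : defect W {s ∈ S | ¬ G.Adj c s} (I.erase c) = defect W {s ∈ S | ¬ G.Adj c s} I := by
    refine Finset.sum_congr rfl fun s hs => ?_
    have : s ≠ c := fun h => hcS (h ▸ (Finset.mem_filter.1 hs).1)
    simp [this]
  have h3 := Finset.add_sum_erase I W hcI
  have h4 : posSum W {s ∈ S | G.Adj c s} + posSum W {s ∈ S | ¬ G.Adj c s} = posSum W S :=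
    Finset.sum_filter_add_sum_filter_not S _ _
  rw [h2] at h1
  linarith

theorem sum_le_and_eq_iff (hcover : C ∪ S = Finset.univ) (hdisj : Disjoint C S)
    (hC : G.IsClique (↑C : Set (Fin n))) [DecidableRel G.Adj] {W : Fin n → ℝ} {x : ℝ}
    (hx : 0 ≤ x) (hW : ∀ c ∈ C, W c ≤ x + posSum W {s ∈ S | G.Adj c s})
    {I : Finset (Fin n)} (hI : IsStable G I) :
    ∑ i ∈ I, W i ≤ x + posSum W S ∧
      (∑ i ∈ I, W i = x + posSum W S ↔ IsTight G C S W x I) := by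
  by_cases hd : Disjoint I C
  · have h1 := sum_add_defect W (subset_of_disjoint hcover hd)
    have h2 := defect_nonneg W S I
    refine ⟨by linarith, ⟨fun h => Or.inl ⟨hd, by linarith, ?_⟩, ?_⟩⟩
    · rw [← defect_eq_zero_iff]; linarith
    · rintro (⟨-, h0, h⟩ | ⟨c, hc, hcI, -⟩)
      · rw [← defect_eq_zero_iff] at h; linarith
      · exact absurd hc (Finset.disjoint_left.1 hd hcI)
  · obtain ⟨c, hcI, hc⟩ := Finset.not_disjoint_iff.1 hd
    have h1 := sum_add_defect_of_mem hcover hdisj hC W hI hc hcI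
    have h2 := defect_nonneg W {s ∈ S | ¬ G.Adj c s} I
    have h3 := hW c hc
    refine ⟨by linarith, ⟨fun h => Or.inr ⟨c, hc, hcI, by linarith, ?_⟩, ?_⟩⟩
    · have : defect W {s ∈ S | ¬ G.Adj c s} I = 0 := by linarith
      rw [defect_eq_zero_iff] at this
      exact fun s hs h => this s (Finset.mem_filter.2 ⟨hs, h⟩)
    · rintro (⟨h, -⟩ | ⟨c', hc', hcI', h0, h⟩)
      · exact absurd h hd
      · obtain rfl : c = c' := by
          by_contra hne
          exact hI hcI hcI' (hC hc hc' hne)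
        have : defect W {s ∈ S | ¬ G.Adj c s} I = 0 := by
          rw [defect_eq_zero_iff]
          intro s hs
          exact h s (Finset.mem_filter.1 hs).1 (Finset.mem_filter.1 hs).2
        linarith

/-- A sign pattern on `S` that is compatible with a stable subset of `S` omitting or containing
a given vertex. -/
theorem exists_compat_disjoint {α : Type*} [Zero α] [LinearOrder α] (hdisj : Disjoint C S)
    (hS : IsStable G S) (W : Fin n → α) (t : Fin n) (p : Prop) (ht : SignCompat (W t) p)
    (htS : t ∈ S) :
    ∃ I, IsStable G I ∧ Disjoint I C ∧ (t ∈ I ↔ p) ∧ ∀ s ∈ S, SignCompat (W s) (s ∈ I) := by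
  classical
  refine ⟨S.filter fun s => 0 ≤ W s ∧ (s = t → p), isStable_of_subset hS (Finset.filter_subset _ _),
    hdisj.symm.mono_left (Finset.filter_subset _ _), ?_, fun s hs => ?_⟩
  · simp only [Finset.mem_filter]
    exact ⟨fun h => by simpa using h.2.2, fun h => ⟨htS, ht.1 h, fun _ => h⟩⟩
  · simp only [Finset.mem_filter, hs, true_and]
    refine ⟨fun h => h.1, fun h => ?_⟩
    by_cases h0 : 0 ≤ W s
    · have : s = t ∧ ¬ p := by tauto
      rw [this.1]
      exact ht.2 this.2
    · exact (lt_of_not_ge h0).le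

theorem exists_compat_mem {α : Type*} [Zero α] [LinearOrder α] (hdisj : Disjoint C S)
    (hS : IsStable G S) (W : Fin n → α) {c : Fin n} (hc : c ∈ C) (t : Fin n) (p : Prop)
    (ht : SignCompat (W t) p) (htS : t ∈ S) (hct : ¬ G.Adj c t) :
    ∃ I, IsStable G I ∧ c ∈ I ∧ (t ∈ I ↔ p) ∧
      ∀ s ∈ S, ¬ G.Adj c s → SignCompat (W s) (s ∈ I) := by
  classical
  have hne (s) (hs : s ∈ S) : s ≠ c := fun h => Finset.disjoint_left.1 hdisj hc (h ▸ hs)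
  refine ⟨insert c (S.filter fun s => ¬ G.Adj c s ∧ 0 ≤ W s ∧ (s = t → p)),
    isStable_insert (isStable_of_subset hS (Finset.filter_subset _ _))
      (fun s hs => (Finset.mem_filter.1 hs).2.1), Finset.mem_insert_self _ _, ?_,
      fun s hs hcs => ?_⟩
  · simp only [Finset.mem_insert, hne t htS, false_or, Finset.mem_filter]
    exact ⟨fun h => by simpa using h.2.2.2, fun h => ⟨htS, hct, ht.1 h, fun _ => h⟩⟩
  · simp only [Finset.mem_insert, hne s hs, false_or, Finset.mem_filter, hs, true_and, hcs,
      not_false_eq_true]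
    refine ⟨fun h => h.1, fun h => ?_⟩
    by_cases h0 : 0 ≤ W s
    · have : s = t ∧ ¬ p := by tauto
      rw [this.1]
      exact ht.2 this.2
    · exact (lt_of_not_ge h0).le

theorem exists_compat_disjoint' {α : Type*} [Zero α] [LinearOrder α] (hdisj : Disjoint C S)
    (hS : IsStable G S) (W : Fin n → α) :
    ∃ I, IsStable G I ∧ Disjoint I C ∧ ∀ s ∈ S, SignCompat (W s) (s ∈ I) := by
  refine ⟨S.filter fun s => 0 ≤ W s, isStable_of_subset hS (Finset.filter_subset _ _),
    hdisj.symm.mono_left (Finset.filter_subset _ _), fun s hs => ?_⟩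
  simp only [Finset.mem_filter, hs, true_and]
  exact ⟨id, fun h => (lt_of_not_ge h).le⟩

theorem exists_compat_mem' {α : Type*} [Zero α] [LinearOrder α] (hdisj : Disjoint C S)
    (hS : IsStable G S) (W : Fin n → α) {c : Fin n} (hc : c ∈ C) :
    ∃ I, IsStable G I ∧ c ∈ I ∧ ∀ s ∈ S, ¬ G.Adj c s → SignCompat (W s) (s ∈ I) := by
  classical
  have hne (s) (hs : s ∈ S) : s ≠ c := fun h => Finset.disjoint_left.1 hdisj hc (h ▸ hs)
  refine ⟨insert c (S.filter fun s => ¬ G.Adj c s ∧ 0 ≤ W s),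
    isStable_insert (isStable_of_subset hS (Finset.filter_subset _ _))
      (fun s hs => (Finset.mem_filter.1 hs).2.1), Finset.mem_insert_self _ _, fun s hs hcs => ?_⟩
  simp only [Finset.mem_insert, hne s hs, false_or, Finset.mem_filter, hs, true_and, hcs,
    not_false_eq_true]
  exact ⟨id, fun h => (lt_of_not_ge h).le⟩

theorem slack_bounds (hcover : C ∪ S = Finset.univ) (hdisj : Disjoint C S)
    (hC : G.IsClique (↑C : Set (Fin n))) (hS : IsStable G S) [DecidableRel G.Adj]
    {W : Fin n → ℝ} {x : ℝ}
    (h : ∀ I, IsStable G I → ∑ i ∈ I, W i ≤ x + posSum W S) :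
    0 ≤ x ∧ ∀ c ∈ C, W c ≤ x + posSum W {s ∈ S | G.Adj c s} := by
  constructor
  · obtain ⟨I, hI, hd, hc⟩ := exists_compat_disjoint' hdisj hS W
    have h1 := sum_add_defect W (subset_of_disjoint hcover hd)
    rw [(defect_eq_zero_iff _ _ _).2 hc] at h1
    linarith [h I hI]
  · intro c hc
    obtain ⟨I, hI, hcI, hcomp⟩ := exists_compat_mem' hdisj hS W hc
    have h1 := sum_add_defect_of_mem hcover hdisj hC W hI hc hcI
    rw [(defect_eq_zero_iff _ _ _).2 fun s hs =>
      hcomp s (Finset.mem_filter.1 hs).1 (Finset.mem_filter.1 hs).2] at h1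
    linarith [h I hI]

/-- The component of `z` selected by the sign. -/
def signBit (z : Bool × Bool) (ε : Bool) : Bool := cond ε z.1 z.2

/-- The clique vertex `c` is tight on the side `ε` according to the code `κ`. -/
def CodeTight (G : SimpleGraph (Fin n)) (S : Finset (Fin n))
    (κ : (Bool × Bool) × (Fin n → SignType)) (ε : Bool) (c : Fin n) : Prop :=
  κ.2 c = boolSign ε ∨ (κ.1 = (true, true) ∧ ∀ s ∈ S, G.Adj c s → κ.2 s = 0)

/-- The signed vertices of the face with code `κ`. -/
def codeVerts (G : SimpleGraph (Fin n)) (C S : Finset (Fin n))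
    (κ : (Bool × Bool) × (Fin n → SignType)) : Set (Bool × Finset (Fin n)) :=
  {q | IsStable G q.2 ∧
    ((Disjoint q.2 C ∧ signBit κ.1 q.1 = true ∧
        ∀ s ∈ S, SignCompat (boolSign q.1 * κ.2 s) (s ∈ q.2)) ∨
      ∃ c ∈ C, c ∈ q.2 ∧ CodeTight G S κ q.1 c ∧
        ∀ s ∈ S, ¬ G.Adj c s → SignCompat (boolSign q.1 * κ.2 s) (s ∈ q.2))}

theorem signBit_iff (hdisj : Disjoint C S) (hS : IsStable G S)
    (κ : (Bool × Bool) × (Fin n → SignType)) (ε : Bool) :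
    signBit κ.1 ε = true ↔ ∃ I, Disjoint I C ∧ (ε, I) ∈ codeVerts G C S κ := by
  constructor
  · intro h
    obtain ⟨I, hI, hd, hc⟩ := exists_compat_disjoint' hdisj hS fun s => boolSign ε * κ.2 s
    exact ⟨I, hd, hI, Or.inl ⟨hd, h, hc⟩⟩
  · rintro ⟨I, hd, -, ⟨-, h, -⟩ | ⟨c, hc, hcI, -⟩⟩
    · exact h
    · exact absurd hc (Finset.disjoint_left.1 hd hcI)

theorem codeTight_iff (hdisj : Disjoint C S) (hC : G.IsClique (↑C : Set (Fin n)))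
    (hS : IsStable G S) (κ : (Bool × Bool) × (Fin n → SignType)) (ε : Bool) {c : Fin n}
    (hc : c ∈ C) :
    CodeTight G S κ ε c ↔ ∃ I, c ∈ I ∧ (ε, I) ∈ codeVerts G C S κ := by
  constructor
  · intro h
    obtain ⟨I, hI, hcI, hcomp⟩ := exists_compat_mem' hdisj hS (fun s => boolSign ε * κ.2 s) hc
    exact ⟨I, hcI, hI, Or.inr ⟨c, hc, hcI, h, hcomp⟩⟩
  · rintro ⟨I, hcI, hI, ⟨hd, -⟩ | ⟨c', hc', hcI', h, -⟩⟩
    · exact absurd hc (Finset.disjoint_left.1 hd hcI)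
    · obtain rfl : c = c' := by
        by_contra hne
        exact hI hcI hcI' (hC hc hc' hne)
      exact h

theorem signCompat_iff_of_signBit (hdisj : Disjoint C S) (hS : IsStable G S)
    {κ : (Bool × Bool) × (Fin n → SignType)} {ε : Bool} (h : signBit κ.1 ε = true) {t : Fin n}
    (ht : t ∈ S) (p : Prop) :
    SignCompat (boolSign ε * κ.2 t) p ↔
      ∃ I, Disjoint I C ∧ (t ∈ I ↔ p) ∧ (ε, I) ∈ codeVerts G C S κ := by
  constructor
  · intro hp
    obtain ⟨I, hI, hd, hi, hc⟩ :=
      exists_compat_disjoint hdisj hS (fun s => boolSign ε * κ.2 s) t p hp ht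
    exact ⟨I, hd, hi, hI, Or.inl ⟨hd, h, hc⟩⟩
  · rintro ⟨I, hd, hi, -, ⟨-, -, h⟩ | ⟨c, hc, hcI, -⟩⟩
    · rw [← propext hi]
      exact h t ht
    · exact absurd hc (Finset.disjoint_left.1 hd hcI)

theorem signCompat_iff_of_codeTight (hdisj : Disjoint C S) (hC : G.IsClique (↑C : Set (Fin n)))
    (hS : IsStable G S) {κ : (Bool × Bool) × (Fin n → SignType)} {ε : Bool} {c : Fin n}
    (hc : c ∈ C) (h : CodeTight G S κ ε c) {t : Fin n} (ht : t ∈ S) (hct : ¬ G.Adj c t)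
    (p : Prop) :
    SignCompat (boolSign ε * κ.2 t) p ↔
      ∃ I, c ∈ I ∧ (t ∈ I ↔ p) ∧ (ε, I) ∈ codeVerts G C S κ := by
  constructor
  · intro hp
    obtain ⟨I, hI, hcI, hi, hcomp⟩ :=
      exists_compat_mem hdisj hS (fun s => boolSign ε * κ.2 s) hc t p hp ht hct
    exact ⟨I, hcI, hi, hI, Or.inr ⟨c, hc, hcI, h, hcomp⟩⟩
  · rintro ⟨I, hcI, hi, hI, ⟨hd, -⟩ | ⟨c', hc', hcI', -, h⟩⟩
    · exact absurd hc (Finset.disjoint_left.1 hd hcI)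
    · obtain rfl : c = c' := by
        by_contra hne
        exact hI hcI hcI' (hC hc hc' hne)
      rw [← propext hi]
      exact h t ht hct

theorem signType_eq_of_signCompat {ε : Bool} {x y : SignType}
    (h : ∀ p, SignCompat (boolSign ε * x) p ↔ SignCompat (boolSign ε * y) p) : x = y := by
  have h1 := h True
  have h2 := h False
  simp only [SignCompat, true_imp_iff, not_true_eq_false, false_imp_iff, and_true,
    not_false_eq_true, true_and] at h1 h2
  clear h
  revert ε x y
  decide

theorem eq_one_iff_codeTight {κ : (Bool × Bool) × (Fin n → SignType)}
    (hκ : κ ∈ faceCodes G C S) {c : Fin n} (hc : c ∈ C) (ε : Bool) :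
    κ.2 c = boolSign ε ↔ CodeTight G S κ ε c ∧ ¬ CodeTight G S κ (!ε) c := by
  have hne : boolSign ε ≠ boolSign (!ε) := by cases ε <;> decide
  constructor
  · refine fun h => ⟨Or.inl h, ?_⟩
    rintro (h' | ⟨h1, h2⟩)
    · exact hne (h.symm.trans h')
    · obtain ⟨s, hs, hcs, h0⟩ := hκ.1 h1 c hc (h ▸ boolSign_ne_zero ε)
      exact h0 (h2 s hs hcs)
  · rintro ⟨h | h, h'⟩
    · exact h
    · exact absurd (Or.inr h) h'

theorem injOn_codeVerts (hdisj : Disjoint C S) (hcover : C ∪ S = Finset.univ)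
    (hC : G.IsClique (↑C : Set (Fin n))) (hS : IsStable G S) :
    Set.InjOn (codeVerts G C S) (faceCodes G C S) := by
  rintro κ hκ κ' hκ' h
  have hbit (ε) : signBit κ.1 ε = true ↔ signBit κ'.1 ε = true := by
    rw [signBit_iff hdisj hS, signBit_iff hdisj hS, h]
  have htight (ε) (c) (hc : c ∈ C) : CodeTight G S κ ε c ↔ CodeTight G S κ' ε c := by
    rw [codeTight_iff hdisj hC hS _ _ hc, codeTight_iff hdisj hC hS _ _ hc, h]
  have hz : κ.1 = κ'.1 :=
    Prod.ext (Bool.eq_iff_iff.2 (hbit true)) (Bool.eq_iff_iff.2 (hbit false))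
  have hθC (c) (hc : c ∈ C) : κ.2 c = κ'.2 c := by
    have hs (ε) : κ.2 c = boolSign ε ↔ κ'.2 c = boolSign ε := by
      rw [eq_one_iff_codeTight hκ hc, eq_one_iff_codeTight hκ' hc, htight _ _ hc, htight _ _ hc]
    have hext : ∀ x y : SignType, (x = 1 ↔ y = 1) → (x = -1 ↔ y = -1) → x = y := by decide
    exact hext _ _ (hs true) (hs false)
  refine Prod.ext hz (funext fun t => ?_)
  rcases Finset.mem_union.1 (hcover ▸ Finset.mem_univ t : t ∈ C ∪ S) with ht | ht
  · exact hθC t ht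
  · by_cases hex : ∃ ε, signBit κ.1 ε = true
    · obtain ⟨ε, hε⟩ := hex
      refine signType_eq_of_signCompat (ε := ε) fun p => ?_
      rw [signCompat_iff_of_signBit hdisj hS hε ht,
        signCompat_iff_of_signBit hdisj hS ((hbit ε).1 hε) ht, h]
    · push Not at hex
      have hff : κ.1 = (false, false) :=
        Prod.ext (by simpa [signBit] using hex true) (by simpa [signBit] using hex false)
      by_cases hnn : ∃ c ∈ C, ¬ G.Adj c t ∧ κ.2 c ≠ 0
      · obtain ⟨c, hc, hct, h0⟩ := hnn
        obtain ⟨ε, hε⟩ : ∃ ε, κ.2 c = boolSign ε := by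
          generalize κ.2 c = x at h0
          revert x; decide
        refine signType_eq_of_signCompat (ε := ε) fun p => ?_
        rw [signCompat_iff_of_codeTight hdisj hC hS hc (Or.inl hε) ht hct,
          signCompat_iff_of_codeTight hdisj hC hS hc (Or.inl (hθC c hc ▸ hε)) ht hct, h]
      · have h1 : κ.2 t = 0 := by
          by_contra h0
          exact hnn ((hκ.2 hff).1 t ht h0)
        have h2 : κ'.2 t = 0 := by
          by_contra h0
          obtain ⟨c, hc, hct, h3⟩ := (hκ'.2 (hz ▸ hff)).1 t ht h0
          exact hnn ⟨c, hc, hct, by rwa [hθC c hc]⟩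
        rw [h1, h2]

end

section

variable {n : ℕ} {G : SimpleGraph (Fin n)} {C S : Finset (Fin n)}

theorem vertVal_eq (a : ℝ) (w : Fin n → ℝ) (ε : Bool) (I : Finset (Fin n)) :
    vertVal a w (ε, I) = (boolSign ε : ℝ) * a + ∑ i ∈ I, (boolSign ε : ℝ) * w i := by
  rw [vertVal, mul_add, Finset.mul_sum]

theorem signCompat_sign {ε : Bool} {x : ℝ} {y : SignType} (h : y = SignType.sign x) (p : Prop) :
    SignCompat ((boolSign ε : ℝ) * x) p ↔ SignCompat (boolSign ε * y) p := by
  subst h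
  have h1 : boolSign ε * SignType.sign x = SignType.sign ((boolSign ε : ℝ) * x) := by
    cases ε <;> simp [boolSign, Left.sign_neg]
  rw [h1, SignCompat, SignCompat, sign_nonneg_iff, sign_nonpos_iff]

theorem optSet_eq_of_isTight (hcover : C ∪ S = Finset.univ) (hdisj : Disjoint C S)
    (hC : G.IsClique (↑C : Set (Fin n))) [DecidableRel G.Adj] {a M : ℝ} {w : Fin n → ℝ}
    {x : Bool → ℝ}
    (hM : ∀ ε, (boolSign ε : ℝ) * a + x ε + posSum (fun i => (boolSign ε : ℝ) * w i) S = M)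
    (hx : ∀ ε, 0 ≤ x ε)
    (hw : ∀ ε, ∀ c ∈ C, (boolSign ε : ℝ) * w c ≤
      x ε + posSum (fun i => (boolSign ε : ℝ) * w i) {s ∈ S | G.Adj c s})
    (hex : ∃ q : Bool × Finset (Fin n), IsStable G q.2 ∧
      IsTight G C S (fun i => (boolSign q.1 : ℝ) * w i) (x q.1) q.2) :
    optSet G a w = {q | IsStable G q.2 ∧
      IsTight G C S (fun i => (boolSign q.1 : ℝ) * w i) (x q.1) q.2} := by
  have key (ε) (I) (hI : IsStable G I) : vertVal a w (ε, I) ≤ M ∧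
      (vertVal a w (ε, I) = M ↔ IsTight G C S (fun i => (boolSign ε : ℝ) * w i) (x ε) I) := by
    obtain ⟨h1, h2⟩ := sum_le_and_eq_iff hcover hdisj hC (hx ε) (hw ε) hI
    have := hM ε
    rw [vertVal_eq, ← h2]
    exact ⟨by linarith, by constructor <;> intro h <;> linarith⟩
  obtain ⟨⟨ε₀, I₀⟩, hI₀, ht₀⟩ := hex
  ext ⟨ε, I⟩
  refine and_congr_right fun hI => ?_
  rw [← (key ε I hI).2]
  constructor
  · intro h
    have := h (ε₀, I₀) hI₀
    rw [(key ε₀ I₀ hI₀).2.2 ht₀] at this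
    exact le_antisymm (key ε I hI).1 this
  · rintro h ⟨ε', I'⟩ hI'
    rw [h]
    exact (key ε' I' hI').1

theorem isTight_set_eq_codeVerts [DecidableRel G.Adj] {w : Fin n → ℝ} {x : Bool → ℝ}
    {κ : (Bool × Bool) × (Fin n → SignType)}
    (hbit : ∀ ε, signBit κ.1 ε = true ↔ x ε = 0)
    (htight : ∀ ε, ∀ c ∈ C, CodeTight G S κ ε c ↔
      (boolSign ε : ℝ) * w c = x ε + posSum (fun i => (boolSign ε : ℝ) * w i) {s ∈ S | G.Adj c s})
    (hsign : ∀ s ∈ S, (∃ ε, signBit κ.1 ε = true) → κ.2 s = SignType.sign (w s))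
    (hsign' : ∀ s ∈ S, ∀ c ∈ C, ¬ G.Adj c s → κ.2 c ≠ 0 → κ.2 s = SignType.sign (w s)) :
    {q | IsStable G q.2 ∧ IsTight G C S (fun i => (boolSign q.1 : ℝ) * w i) (x q.1) q.2} =
      codeVerts G C S κ := by
  ext ⟨ε, I⟩
  refine and_congr_right fun hI => or_congr ?_ ?_
  · refine and_congr_right fun _ => ?_
    simp only
    rw [← hbit ε]
    refine and_congr_right fun hb => forall₂_congr fun s hs => ?_
    exact signCompat_sign (hsign s hs ⟨ε, hb⟩) _
  · refine exists_congr fun c => and_congr_right fun hc => and_congr_right fun _ => ?_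
    simp only
    rw [← htight ε c hc]
    refine and_congr_right fun ht => forall₃_congr fun s hs hcs => ?_
    refine signCompat_sign ?_ _
    rcases ht with h | ⟨h, -⟩
    · exact hsign' s hs c hc hcs (h ▸ boolSign_ne_zero ε)
    · exact hsign s hs ⟨true, by simp [signBit, h]⟩

theorem exists_isTight (hdisj : Disjoint C S) (hS : IsStable G S) [DecidableRel G.Adj]
    {W : Fin n → ℝ} {x : ℝ}
    (h : x = 0 ∨ ∃ c ∈ C, W c = x + posSum W {s ∈ S | G.Adj c s}) :
    ∃ I, IsStable G I ∧ IsTight G C S W x I := by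
  rcases h with h | ⟨c, hc, h⟩
  · obtain ⟨I, hI, hd, hcomp⟩ := exists_compat_disjoint' hdisj hS W
    exact ⟨I, hI, Or.inl ⟨hd, h, hcomp⟩⟩
  · obtain ⟨I, hI, hcI, hcomp⟩ := exists_compat_mem' hdisj hS W hc
    exact ⟨I, hI, Or.inr ⟨c, hc, hcI, h, hcomp⟩⟩

/-- The absolute weight of `T` vanishes exactly when all weights on `T` do. -/
theorem posSum_add_posSum_neg_eq_zero_iff (w : Fin n → ℝ) (T : Finset (Fin n)) :
    posSum (fun i => (boolSign true : ℝ) * w i) T + posSum (fun i => (boolSign false : ℝ) * w i) T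
      = 0 ↔ ∀ s ∈ T, w s = 0 := by
  rw [add_eq_zero_iff_of_nonneg (posSum_nonneg _ _) (posSum_nonneg _ _), posSum_eq_zero_iff,
    posSum_eq_zero_iff]
  simp only [boolSign, if_true, SignType.coe_one, one_mul, Bool.false_eq_true, if_false,
    SignType.coe_neg_one, neg_mul, Left.neg_nonpos_iff]
  exact ⟨fun h s hs => le_antisymm (h.1 s hs) (h.2 s hs),
    fun h => ⟨fun s hs => (h s hs).le, fun s hs => (h s hs).ge⟩⟩

theorem exists_code_of_optSet (hdisj : Disjoint C S) (hcover : C ∪ S = Finset.univ)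
    (hC : G.IsClique (↑C : Set (Fin n))) (hS : IsStable G S) (a : ℝ) (w : Fin n → ℝ) :
    ∃ κ ∈ faceCodes G C S, codeVerts G C S κ = optSet G a w := by
  classical
  obtain ⟨q₀, hq₀, hmax⟩ := Set.exists_max_image {q : Bool × Finset (Fin n) | IsStable G q.2}
    (vertVal a w) (Set.toFinite _) ⟨(true, ∅), fun _ h => by simp at h⟩
  set M := vertVal a w q₀ with hMdef
  let p : Bool → Finset (Fin n) → ℝ := fun ε => posSum fun i => (boolSign ε : ℝ) * w i
  have hp (ε T) : 0 ≤ p ε T := posSum_nonneg _ _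
  let x : Bool → ℝ := fun ε => M - (boolSign ε : ℝ) * a - p ε S
  have hM (ε) : (boolSign ε : ℝ) * a + x ε + p ε S = M := by simp only [x]; ring
  have hb (ε) := slack_bounds hcover hdisj hC hS (W := fun i => (boolSign ε : ℝ) * w i) (x := x ε)
    (fun I hI => by
      have h1 : vertVal a w (ε, I) ≤ M := hmax (ε, I) hI
      rw [vertVal_eq] at h1
      have h2 := hM ε
      simp only [p] at h2
      linarith)
  have hx (ε) : 0 ≤ x ε := (hb ε).1
  have hw (ε) : ∀ c ∈ C, (boolSign ε : ℝ) * w c ≤ x ε + p ε {s ∈ S | G.Adj c s} := (hb ε).2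
  have ht₀ : IsTight G C S (fun i => (boolSign q₀.1 : ℝ) * w i) (x q₀.1) q₀.2 := by
    rw [← (sum_le_and_eq_iff hcover hdisj hC (hx q₀.1) (hw q₀.1) hq₀).2]
    have h1 : M = (boolSign q₀.1 : ℝ) * a + ∑ i ∈ q₀.2, (boolSign q₀.1 : ℝ) * w i :=
      vertVal_eq a w q₀.1 q₀.2
    have h2 := hM q₀.1
    simp only [p] at h2
    linarith
  rw [optSet_eq_of_isTight hcover hdisj hC hM hx hw ⟨q₀, hq₀, ht₀⟩]
  let h : Fin n → ℝ := fun c =>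
    x true + x false + (p true {s ∈ S | G.Adj c s} + p false {s ∈ S | G.Adj c s})
  let τ : Fin n → SignType := fun c => if h c = 0 then 0 else
    if w c = x true + p true {s ∈ S | G.Adj c s} then 1 else
    if -w c = x false + p false {s ∈ S | G.Adj c s} then -1 else 0
  let z : Bool × Bool := (decide (x true = 0), decide (x false = 0))
  let θ : Fin n → SignType := fun i => if i ∈ C then τ i else
    if (∃ ε, signBit z ε = true) ∨ ∃ c ∈ C, ¬ G.Adj c i ∧ τ c ≠ 0 then SignType.sign (w i) else 0
  have hθC (c) (hc : c ∈ C) : θ c = τ c := by simp [θ, hc]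
  have hθS (s) (hs : s ∈ S) : θ s = if (∃ ε, signBit z ε = true) ∨ ∃ c ∈ C, ¬ G.Adj c s ∧ τ c ≠ 0
      then SignType.sign (w s) else 0 := by
    simp [θ, Finset.disjoint_right.1 hdisj hs]
  have hbit (ε) : signBit z ε = true ↔ x ε = 0 := by cases ε <;> simp [signBit, z]
  have hzt : z = (true, true) ↔ x true = 0 ∧ x false = 0 := by simp [z]
  have hh (c) : h c = 0 ↔ z = (true, true) ∧ ∀ s ∈ S, G.Adj c s → w s = 0 := by
    have h1 := posSum_add_posSum_neg_eq_zero_iff w {s ∈ S | G.Adj c s}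
    have h2 := hx true
    have h3 := hx false
    have h4 := add_nonneg (hp true {s ∈ S | G.Adj c s}) (hp false {s ∈ S | G.Adj c s})
    simp only [Finset.mem_filter, and_imp] at h1
    rw [hzt, ← h1]
    simp only [h, p] at h4 ⊢
    constructor
    · intro h5
      refine ⟨⟨?_, ?_⟩, ?_⟩ <;> linarith
    · rintro ⟨⟨h5, h6⟩, h7⟩
      rw [h5, h6, h7]; simp
  have hzex (hz : z = (true, true)) : ∃ ε, signBit z ε = true := ⟨true, by simp [hz, signBit]⟩
  have hdeg (c) (hc : c ∈ C) (h0 : h c = 0) (ε) :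
      (boolSign ε : ℝ) * w c = x ε + p ε {s ∈ S | G.Adj c s} := by
    have h1 := hw true c hc
    have h2 := hw false c hc
    simp only [h] at h0
    cases ε <;> simp only [boolSign, if_true, SignType.coe_one, one_mul, Bool.false_eq_true,
      if_false, SignType.coe_neg_one, neg_mul] at h1 h2 ⊢ <;> linarith
  have htight (ε) (c) (hc : c ∈ C) : CodeTight G S (z, θ) ε c ↔
      (boolSign ε : ℝ) * w c = x ε + p ε {s ∈ S | G.Adj c s} := by
    have hsecond : (z = (true, true) ∧ ∀ s ∈ S, G.Adj c s → θ s = 0) ↔ h c = 0 := by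
      rw [hh]
      refine and_congr_right fun hz => forall₂_congr fun s hs => ?_
      rw [hθS s hs, if_pos (Or.inl (hzex hz)), sign_eq_zero_iff]
    rw [CodeTight, hsecond]
    by_cases h0 : h c = 0
    · exact iff_of_true (Or.inr h0) (hdeg c hc h0 ε)
    · simp only [h0, or_false, hθC c hc, τ, if_false]
      cases ε
      · simp only [boolSign, Bool.false_eq_true, if_false, SignType.coe_neg_one, neg_mul, one_mul]
        split_ifs with h1 h2
        · refine iff_of_false (by decide) fun h2 => h0 ?_
          simp only [h]; linarith
        · simp [h2]
        · simp [h2]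
      · simp only [boolSign, if_true, SignType.coe_one, one_mul]
        split_ifs with h1 h2 <;> simp [h1]
  refine ⟨(z, θ), ⟨fun hz c hc h0 => ?_, fun hz => ⟨fun s hs h0 => ?_, fun h0 => ?_⟩⟩, ?_⟩
  · by_contra! hcon
    refine h0 ?_
    have : h c = 0 := by
      rw [hh]
      refine ⟨hz, fun s hs hcs => ?_⟩
      have := hcon s hs hcs
      simp only at this
      rwa [hθS s hs, if_pos (Or.inl (hzex hz)), sign_eq_zero_iff] at this
    simp only [hθC c hc, τ, this, if_true]
  · simp only at h0 hz
    rw [hθS s hs] at h0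
    have hne : ¬ ∃ ε, signBit z ε = true := by
      rintro ⟨ε, hε⟩
      cases ε <;> simp [hz, signBit] at hε
    split_ifs at h0 with h1
    · obtain ⟨c, hc, hcs, h2⟩ := h1.resolve_left hne
      exact ⟨c, hc, hcs, by simpa only [hθC c hc] using h2⟩
    · exact absurd rfl h0
  · simp only at h0 hz
    rcases ht₀ with ⟨-, h1, -⟩ | ⟨c, hc, -, h1, -⟩
    · rw [← hbit] at h1
      cases hq : q₀.1 <;> simp [hz, hq, signBit] at h1
    · rcases (htight q₀.1 c hc).2 h1 with h2 | ⟨h2, -⟩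
      · simp only [h0, Pi.zero_apply] at h2
        exact boolSign_ne_zero _ h2.symm
      · simp [hz] at h2
  · refine (isTight_set_eq_codeVerts hbit htight (fun s hs hex => ?_)
      fun s hs c hc hcs h0 => ?_).symm
    · simp only
      rw [hθS s hs, if_pos (Or.inl hex)]
    · simp only at h0 ⊢
      rw [hθS s hs, if_pos (Or.inr ⟨c, hc, hcs, by rwa [← hθC c hc]⟩)]

/-- The weight of a clique vertex that is tight exactly on the side prescribed by `y`. -/
theorem tight_weight_spec (y : SignType) {u v : ℝ} (hu : 0 ≤ u) (hv : 0 ≤ v) :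
    ((u - v + (y : ℝ) * (u + v)) / 2 ≤ u ∧
      ((u - v + (y : ℝ) * (u + v)) / 2 = u ↔ y = 1 ∨ u + v = 0)) ∧
    (-((u - v + (y : ℝ) * (u + v)) / 2) ≤ v ∧
      (-((u - v + (y : ℝ) * (u + v)) / 2) = v ↔ y = -1 ∨ u + v = 0)) := by
  have hy : y = 0 ∨ y = -1 ∨ y = 1 := by revert y; decide
  rcases hy with rfl | rfl | rfl
  · rw [or_iff_right (by decide), or_iff_right (by decide), SignType.coe_zero]
    exact ⟨⟨by linarith, by constructor <;> intro h <;> linarith⟩,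
      by linarith, by constructor <;> intro h <;> linarith⟩
  · rw [or_iff_right (by decide), SignType.coe_neg_one]
    exact ⟨⟨by linarith, by constructor <;> intro h <;> linarith⟩,
      by linarith, iff_of_true (by linarith) (Or.inl rfl)⟩
  · rw [or_iff_right (by decide : ¬ (1 : SignType) = -1), SignType.coe_one]
    exact ⟨⟨by linarith, iff_of_true (by linarith) (Or.inl rfl)⟩,
      by linarith, by constructor <;> intro h <;> linarith⟩

theorem exists_optSet_of_code (hdisj : Disjoint C S) (hcover : C ∪ S = Finset.univ)
    (hC : G.IsClique (↑C : Set (Fin n))) (hS : IsStable G S)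
    {κ : (Bool × Bool) × (Fin n → SignType)} (hκ : κ ∈ faceCodes G C S) :
    ∃ a w, optSet G a w = codeVerts G C S κ := by
  classical
  let p : Bool → Finset (Fin n) → ℝ := fun ε => posSum fun i => (boolSign ε : ℝ) * (κ.2 i : ℝ)
  have hp (ε T) : 0 ≤ p ε T := posSum_nonneg _ _
  let x : Bool → ℝ := fun ε => if signBit κ.1 ε = true then 0 else 1
  have hx (ε) : 0 ≤ x ε := by simp only [x]; split_ifs <;> norm_num
  let r : Bool → Fin n → ℝ := fun ε c => x ε + p ε {s ∈ S | G.Adj c s}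
  have hr (ε c) : 0 ≤ r ε c := add_nonneg (hx ε) (hp ε _)
  let w : Fin n → ℝ := fun i => if i ∈ C then
    (r true i - r false i + (κ.2 i : ℝ) * (r true i + r false i)) / 2 else (κ.2 i : ℝ)
  have hwC (c) (hc : c ∈ C) :
      w c = (r true c - r false c + (κ.2 c : ℝ) * (r true c + r false c)) / 2 := by simp [w, hc]
  have hwS (s) (hs : s ∈ S) : w s = (κ.2 s : ℝ) := by
    simp [w, Finset.disjoint_right.1 hdisj hs]
  have hpw (ε) (T) (hT : T ⊆ S) : posSum (fun i => (boolSign ε : ℝ) * w i) T = p ε T := by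
    refine Finset.sum_congr rfl fun s hs => ?_
    simp only [hwS s (hT hs)]
  have hbit (ε) : signBit κ.1 ε = true ↔ x ε = 0 := by
    simp only [x]; split_ifs with h <;> simp [h]
  have hzt : κ.1 = (true, true) ↔ x true = 0 ∧ x false = 0 := by
    rw [← hbit, ← hbit, Prod.ext_iff]; rfl
  have hh (c) : r true c + r false c = 0 ↔
      κ.1 = (true, true) ∧ ∀ s ∈ S, G.Adj c s → κ.2 s = 0 := by
    have h1 := posSum_add_posSum_neg_eq_zero_iff (fun i => (κ.2 i : ℝ)) {s ∈ S | G.Adj c s}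
    have h2 := hx true
    have h3 := hx false
    have h4 := add_nonneg (hp true {s ∈ S | G.Adj c s}) (hp false {s ∈ S | G.Adj c s})
    have h8 : ∀ y : SignType, (y : ℝ) = 0 ↔ y = 0 := by
      intro y; cases y <;> simp
    simp only [Finset.mem_filter, and_imp, h8] at h1
    rw [hzt, ← h1]
    simp only [r, p] at h4 ⊢
    constructor
    · intro h5
      refine ⟨⟨?_, ?_⟩, ?_⟩ <;> linarith
    · rintro ⟨⟨h5, h6⟩, h7⟩
      rw [h5, h6]; linarith
  have hle_iff (ε) (c) (hc : c ∈ C) : (boolSign ε : ℝ) * w c ≤ r ε c ∧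
      ((boolSign ε : ℝ) * w c = r ε c ↔ κ.2 c = boolSign ε ∨ r true c + r false c = 0) := by
    have h1 := tight_weight_spec (κ.2 c) (hr true c) (hr false c)
    rw [← hwC c hc] at h1
    cases ε
    · simpa only [boolSign, Bool.false_eq_true, if_false, SignType.coe_neg_one, neg_mul, one_mul]
        using h1.2
    · simpa only [boolSign, if_true, SignType.coe_one, one_mul] using h1.1
  have hsplit (ε c) :
      r ε c = x ε + posSum (fun i => (boolSign ε : ℝ) * w i) {s ∈ S | G.Adj c s} := by
    rw [hpw ε _ (Finset.filter_subset _ _)]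
  have hM (ε) : (boolSign ε : ℝ) * ((x false + p false S - x true - p true S) / 2) + x ε +
      posSum (fun i => (boolSign ε : ℝ) * w i) S =
        (x true + x false + p true S + p false S) / 2 := by
    rw [hpw ε S subset_rfl]
    cases ε <;> simp only [boolSign, Bool.false_eq_true, if_true, if_false, SignType.coe_one,
      SignType.coe_neg_one] <;> ring
  have hw (ε) : ∀ c ∈ C, (boolSign ε : ℝ) * w c ≤
      x ε + posSum (fun i => (boolSign ε : ℝ) * w i) {s ∈ S | G.Adj c s} := fun c hc =>
    (hle_iff ε c hc).1.trans_eq (hsplit ε c)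
  have htight (ε) (c) (hc : c ∈ C) : CodeTight G S κ ε c ↔
      (boolSign ε : ℝ) * w c =
        x ε + posSum (fun i => (boolSign ε : ℝ) * w i) {s ∈ S | G.Adj c s} := by
    rw [CodeTight, ← hh c, ← (hle_iff ε c hc).2, hsplit]
  have hor : ∃ ε, x ε = 0 ∨ ∃ c ∈ C, CodeTight G S κ ε c := by
    by_cases hz : κ.1 = (false, false)
    · obtain ⟨h1, h2⟩ := hκ.2 hz
      obtain ⟨c, hc, h3⟩ : ∃ c ∈ C, κ.2 c ≠ 0 := by
        by_contra! h0
        exact h2 (eq_zero_of_nonNbrCond hcover h1 h0)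
      have h4 : ∀ y : SignType, y ≠ 0 → ∃ ε, y = boolSign ε := by decide
      obtain ⟨ε, hε⟩ := h4 _ h3
      exact ⟨ε, Or.inr ⟨c, hc, Or.inl hε⟩⟩
    · have h1 : ∀ z : Bool × Bool, z ≠ (false, false) → ∃ ε, signBit z ε = true := by decide
      obtain ⟨ε, hε⟩ := h1 _ hz
      exact ⟨ε, Or.inl ((hbit ε).1 hε)⟩
  have hex : ∃ q : Bool × Finset (Fin n), IsStable G q.2 ∧
      IsTight G C S (fun i => (boolSign q.1 : ℝ) * w i) (x q.1) q.2 := by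
    obtain ⟨ε, h⟩ := hor
    obtain ⟨I, hI⟩ := exists_isTight hdisj hS (W := fun i => (boolSign ε : ℝ) * w i) (x := x ε)
      (h.imp_right fun ⟨c, hc, h1⟩ => ⟨c, hc, (htight ε c hc).1 h1⟩)
    exact ⟨(ε, I), hI⟩
  have hsign (s) (hs : s ∈ S) : κ.2 s = SignType.sign (w s) := by
    rw [hwS s hs]
    cases κ.2 s <;> simp
  refine ⟨_, w, (optSet_eq_of_isTight hcover hdisj hC hM hx hw hex).trans ?_⟩
  exact isTight_set_eq_codeVerts hbit htight (fun s hs _ => hsign s hs) fun s hs _ _ _ _ => hsign s hs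

end

/-- Every nonempty set of vertices induces a subgraph with an isolated or a dominating vertex. -/
def HasExtremeVertices {V : Type*} (G : SimpleGraph V) : Prop :=
  ∀ U : Set V, U.Nonempty → ∃ u ∈ U, (∀ v ∈ U, ¬ G.Adj u v) ∨ (∀ v ∈ U, v ≠ u → G.Adj u v)

theorem HasExtremeVertices.of_embedding {V W : Type*} {G : SimpleGraph V} {H : SimpleGraph W}
    (h : HasExtremeVertices H) (f : G ↪g H) : HasExtremeVertices G := by
  intro U hU
  obtain ⟨_, ⟨u, hu, rfl⟩, h⟩ := h (f '' U) (hU.image f)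
  refine ⟨u, hu, h.imp (fun h v hv => ?_) (fun h v hv hne => ?_)⟩
  · rw [← f.map_adj_iff]
    exact h _ ⟨v, hv, rfl⟩
  · rw [← f.map_adj_iff]
    exact h _ ⟨v, hv, rfl⟩ (f.injective.ne hne)

theorem HasExtremeVertices.of_last {n : ℕ} {G : SimpleGraph (Fin n)}
    {H : SimpleGraph (Fin (n + 1))} (h : HasExtremeVertices G)
    (hadj : ∀ i j, H.Adj (Fin.castSucc i) (Fin.castSucc j) ↔ G.Adj i j)
    (hlast : (∀ v, ¬ H.Adj (Fin.last n) v) ∨ ∀ v, v ≠ Fin.last n → H.Adj (Fin.last n) v) :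
    HasExtremeVertices H := by
  intro U hU
  by_cases hl : Fin.last n ∈ U
  · exact ⟨_, hl, hlast.imp (fun h v _ => h v) (fun h v _ => h v)⟩
  · have hcast : ∀ v ∈ U, ∃ j : Fin n, Fin.castSucc j = v := fun v hv =>
      Fin.exists_castSucc_eq.2 fun h => hl (h ▸ hv)
    obtain ⟨u, hu, h⟩ := h (Fin.castSucc ⁻¹' U) (by
      obtain ⟨v, hv⟩ := hU
      obtain ⟨j, rfl⟩ := hcast v hv
      exact ⟨j, hv⟩)
    refine ⟨_, hu, h.imp (fun h v hv => ?_) (fun h v hv hne => ?_)⟩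
    · obtain ⟨j, rfl⟩ := hcast v hv
      rw [hadj]
      exact h j hv
    · obtain ⟨j, rfl⟩ := hcast v hv
      rw [hadj]
      exact h j hv (fun h => hne (h ▸ rfl))

theorem not_map_castSucc_adj_last {n : ℕ} (G : SimpleGraph (Fin n)) (v : Fin (n + 1)) :
    ¬ (G.map Fin.castSuccEmb).Adj (Fin.last n) v := by
  rw [SimpleGraph.map_adj]
  rintro ⟨a, b, -, h, -⟩
  exact Fin.castSucc_ne_last a h

theorem IsThresholdGraph.hasExtremeVertices {n : ℕ} {G : SimpleGraph (Fin n)}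
    (h : IsThresholdGraph G) : HasExtremeVertices G := by
  induction h with
  | empty => exact fun U ⟨x, _⟩ => x.elim0
  | addIsolated _ ih =>
    exact ih.of_last (fun i j => SimpleGraph.map_adj_apply (f := Fin.castSuccEmb))
      (Or.inl (not_map_castSucc_adj_last _))
  | @addDominating n G _ ih =>
    refine ih.of_last (fun i j => ?_) (Or.inr fun v hv => ?_)
    · have : (Gᶜ.map Fin.castSuccEmb).Adj i.castSucc j.castSucc ↔ Gᶜ.Adj i j :=
        SimpleGraph.map_adj_apply (f := Fin.castSuccEmb)
      rw [SimpleGraph.compl_adj, this, SimpleGraph.compl_adj]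
      have : Fin.castSucc i ≠ Fin.castSucc j ↔ i ≠ j := by simp
      rw [this]
      have := G.ne_of_adj (a := i) (b := j)
      tauto
    · rw [SimpleGraph.compl_adj]
      exact ⟨hv.symm, not_map_castSucc_adj_last _ _⟩
  | iso _ e ih => exact ih.of_embedding e.symm.toEmbedding

theorem HasExtremeVertices.isThresholdGraph {n : ℕ} {G : SimpleGraph (Fin n)}
    (h : HasExtremeVertices G) : IsThresholdGraph G := by
  induction n with
  | zero => rw [Subsingleton.elim G ⊥]; exact .empty
  | succ n ih =>
    obtain ⟨u, -, hu⟩ := h Set.univ Set.univ_nonempty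
    let e : Equiv.Perm (Fin (n + 1)) := Equiv.swap u (Fin.last n)
    have hel : e (Fin.last n) = u := Equiv.swap_apply_right _ _
    let H : SimpleGraph (Fin (n + 1)) := G.comap e
    let K : SimpleGraph (Fin n) := H.comap Fin.castSuccEmb
    have hH : HasExtremeVertices H := h.of_embedding (SimpleGraph.Embedding.comap e.toEmbedding G)
    have hK : IsThresholdGraph K := ih (hH.of_embedding (SimpleGraph.Embedding.comap _ H))
    have hmap (i j : Fin n) : (K.map Fin.castSuccEmb).Adj i.castSucc j.castSucc ↔
        H.Adj i.castSucc j.castSucc := SimpleGraph.map_adj_apply (f := Fin.castSuccEmb)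
    have hmap' (i j : Fin n) : (Kᶜ.map Fin.castSuccEmb).Adj i.castSucc j.castSucc ↔
        i ≠ j ∧ ¬ H.Adj i.castSucc j.castSucc := SimpleGraph.map_adj_apply (f := Fin.castSuccEmb)
    have hHl (v) : H.Adj (Fin.last n) v ↔ G.Adj u (e v) := by
      rw [← hel]; rfl
    refine .iso (G := H) ?_ (SimpleGraph.Iso.comap e G)
    rcases hu with hu | hu
    · have hnl (v) : ¬ H.Adj (Fin.last n) v := by
        rw [hHl]; exact hu _ trivial
      convert hK.addIsolated using 1
      ext i j
      induction i using Fin.lastCases with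
      | last => exact iff_of_false (hnl j) (not_map_castSucc_adj_last K j)
      | cast i =>
        induction j using Fin.lastCases with
        | last =>
          rw [SimpleGraph.adj_comm, SimpleGraph.adj_comm (SimpleGraph.map _ _)]
          exact iff_of_false (hnl _) (not_map_castSucc_adj_last K _)
        | cast j => exact (hmap i j).symm
    · have hl (v) (hv : v ≠ Fin.last n) : H.Adj (Fin.last n) v := by
        rw [hHl]; exact hu _ trivial (fun h => hv (e.injective (h.trans hel.symm)))
      convert hK.addDominating using 1
      ext i j
      rw [SimpleGraph.compl_adj]
      induction i using Fin.lastCases with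
      | last =>
        by_cases hj : j = Fin.last n
        · subst hj; simp
        · exact iff_of_true (hl j hj) ⟨fun h => hj h.symm, not_map_castSucc_adj_last _ j⟩
      | cast i =>
        induction j using Fin.lastCases with
        | last =>
          exact iff_of_true (SimpleGraph.Adj.symm (hl _ (Fin.castSucc_ne_last i)))
            ⟨Fin.castSucc_ne_last i, fun h => not_map_castSucc_adj_last _ _ (SimpleGraph.Adj.symm h)⟩
        | cast j =>
          rw [hmap']
          have h1 : i.castSucc ≠ j.castSucc ↔ i ≠ j := by simp
          have := H.ne_of_adj (a := i.castSucc) (b := j.castSucc)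
          rw [h1] at *
          tauto

/-- An alternating 4-cycle between `C` and `S`. -/
def HasAlternatingCycle {n : ℕ} (G : SimpleGraph (Fin n)) (C S : Finset (Fin n)) : Prop :=
  ∃ c ∈ C, ∃ c' ∈ C, ∃ s ∈ S, ∃ s' ∈ S,
    G.Adj c s ∧ ¬ G.Adj c' s ∧ G.Adj c' s' ∧ ¬ G.Adj c s'

theorem hasExtremeVertices_iff {n : ℕ} {G : SimpleGraph (Fin n)}
    {C S : Finset (Fin n)} (hdisj : Disjoint C S) (hcover : C ∪ S = Finset.univ)
    (hC : G.IsClique (↑C : Set (Fin n))) (hS : IsStable G S) :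
    HasExtremeVertices G ↔ ¬ HasAlternatingCycle G C S := by
  classical
  have hd := Finset.disjoint_left.1 hdisj
  have hcov (i : Fin n) : i ∈ C ∨ i ∈ S :=
    Finset.mem_union.1 (hcover ▸ Finset.mem_univ i : i ∈ C ∪ S)
  constructor
  · rintro h ⟨c, hc, c', hc', s, hs, s', hs', h1, h2, h3, h4⟩
    obtain ⟨u, hu, h⟩ := h {c, c', s, s'} ⟨c, by simp⟩
    have hcs : c ≠ s := fun h => hd hc (h ▸ hs)
    have hcs' : c ≠ s' := fun h => hd hc (h ▸ hs')
    have hcs2 : c' ≠ s := fun h => hd hc' (h ▸ hs)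
    have hcs2' : c' ≠ s' := fun h => hd hc' (h ▸ hs')
    have h2' := fun h => h2 (SimpleGraph.Adj.symm h)
    have h4' := fun h => h4 (SimpleGraph.Adj.symm h)
    simp only [Set.mem_insert_iff, Set.mem_singleton_iff, forall_eq_or_imp, forall_eq] at hu h
    rcases hu with rfl | rfl | rfl | rfl
    · grind
    · grind
    · have := h1.symm; grind
    · have := h3.symm; grind
  · intro h U hU
    by_cases hX : ∃ c ∈ C, c ∈ U
    · obtain ⟨c, hc, hmax⟩ := Finset.exists_max_image (C.filter (· ∈ U))
        (fun c => (S.filter fun s => s ∈ U ∧ G.Adj c s).card)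
        (by obtain ⟨c, h1, h2⟩ := hX; exact ⟨c, by simp [h1, h2]⟩)
      simp only [Finset.mem_filter] at hc hmax
      by_cases hdom : ∀ s ∈ S, s ∈ U → G.Adj c s
      · refine ⟨c, hc.2, Or.inr fun v hv hne => ?_⟩
        rcases hcov v with h | h
        · exact hC hc.1 h hne.symm
        · exact hdom v h hv
      · push Not at hdom
        obtain ⟨s, hs, hsU, hcs⟩ := hdom
        refine ⟨s, hsU, Or.inl fun v hv hadj => ?_⟩
        rcases hcov v with hvC | hvS
        · have hle := hmax v ⟨hvC, hv⟩
          have hns : ¬ (S.filter fun s => s ∈ U ∧ G.Adj c s) ⊆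
              (S.filter fun s => s ∈ U ∧ G.Adj v s) := by
            intro hsub
            have heq := Finset.eq_of_subset_of_card_le hsub hle
            have : s ∈ S.filter fun s => s ∈ U ∧ G.Adj v s := by simp [hs, hsU, hadj.symm]
            rw [← heq] at this
            simp [hcs] at this
          rw [Finset.not_subset] at hns
          obtain ⟨s', h1, h2⟩ := hns
          simp only [Finset.mem_filter, not_and] at h1 h2
          exact h ⟨v, hvC, c, hc.1, s, hs, s', h1.1, hadj.symm, hcs, h1.2.2, h2 h1.1 h1.2.1⟩
        · exact hS hs hvS hadj
    · push Not at hX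
      obtain ⟨u, hu⟩ := hU
      refine ⟨u, hu, Or.inl fun v hv => hS ?_ ?_⟩
      · exact (hcov u).resolve_left fun h => hX u h hu
      · exact (hcov v).resolve_left fun h => hX v h hv

theorem exists_sign_iff_hasAlternatingCycle {n : ℕ} {G : SimpleGraph (Fin n)}
    {C S : Finset (Fin n)} (hdisj : Disjoint C S) (hcover : C ∪ S = Finset.univ) :
    (∃ θ : Fin n → SignType, NbrCond G C S θ ∧ NonNbrCond G C S θ ∧ θ ≠ 0) ↔
      HasAlternatingCycle G C S := by
  classical
  have hd := Finset.disjoint_left.1 hdisj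
  constructor
  · rintro ⟨θ, hA, hB, hne⟩
    have hX : ∃ c ∈ C, θ c ≠ 0 := by
      by_contra! h
      exact hne (eq_zero_of_nonNbrCond hcover hB h)
    obtain ⟨c, hc, hmin⟩ := Finset.exists_min_image (C.filter (θ · ≠ 0))
      (fun c => (S.filter fun s => θ s ≠ 0 ∧ G.Adj c s).card)
      (by obtain ⟨c, h1, h2⟩ := hX; exact ⟨c, by simp [h1, h2]⟩)
    simp only [Finset.mem_filter] at hc hmin
    obtain ⟨s, hs, hcs, hθs⟩ := hA c hc.1 hc.2
    obtain ⟨c', hc', hcs', hθc'⟩ := hB s hs hθs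
    have hle := hmin c' ⟨hc', hθc'⟩
    have hns : ¬ (S.filter fun s => θ s ≠ 0 ∧ G.Adj c' s) ⊆
        (S.filter fun s => θ s ≠ 0 ∧ G.Adj c s) := by
      intro hsub
      have heq := Finset.eq_of_subset_of_card_le hsub hle
      have : s ∈ S.filter fun s => θ s ≠ 0 ∧ G.Adj c s := by simp [hs, hcs, hθs]
      rw [← heq] at this
      simp [hcs'] at this
    rw [Finset.not_subset] at hns
    obtain ⟨s', h1, h2⟩ := hns
    simp only [Finset.mem_filter, not_and] at h1 h2
    exact ⟨c, hc.1, c', hc', s, hs, s', h1.1, hcs, hcs', h1.2.2, h2 h1.1 h1.2.1⟩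
  · rintro ⟨c, hc, c', hc', s, hs, s', hs', h1, h2, h3, h4⟩
    refine ⟨fun i => if i = c ∨ i = c' ∨ i = s ∨ i = s' then 1 else 0, ?_, ?_, ?_⟩
    · intro b hb h
      have : b = c ∨ b = c' := by grind
      rcases this with rfl | rfl
      · exact ⟨s, hs, h1, by simp⟩
      · exact ⟨s', hs', h3, by simp⟩
    · intro b hb h
      have : b = s ∨ b = s' := by grind
      rcases this with rfl | rfl
      · exact ⟨c', hc', h2, by simp⟩
      · exact ⟨c, hc, h4, by simp⟩
    · intro h
      have := congrFun h c
      simp at this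

theorem pG_eq_zero_iff {n : ℕ} {G : SimpleGraph (Fin n)} {C S : Finset (Fin n)}
    (hdisj : Disjoint C S) (hcover : C ∪ S = Finset.univ)
    (hC : G.IsClique (↑C : Set (Fin n))) (hS : IsStable G S) :
    pG G C S = 0 ↔ IsThresholdGraph G := by
  have h1 : IsThresholdGraph G ↔ HasExtremeVertices G :=
    ⟨fun h => h.hasExtremeVertices, fun h => h.isThresholdGraph⟩
  rw [h1, hasExtremeVertices_iff hdisj hcover hC hS,
    ← exists_sign_iff_hasAlternatingCycle hdisj hcover, pG_eq_ncard G C S hdisj hcover,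
    Set.ncard_eq_zero, Set.eq_empty_iff_forall_notMem, not_exists]
  rfl

theorem numFaces_hansenPolytope_split {n : ℕ} (G : SimpleGraph (Fin n))
    (C S : Finset (Fin n)) (hdisj : Disjoint C S) (hcover : C ∪ S = Finset.univ)
    (hC : G.IsClique (↑C : Set (Fin n))) (hS : IsStable G S) :
    numFaces (hansenPolytope G) = 3 ^ (n + 1) + pG G C S := by
  have h : (Set.range fun p : ℝ × (Fin n → ℝ) => optSet G p.1 p.2) =
      codeVerts G C S '' faceCodes G C S := by
    ext Q
    constructor
    · rintro ⟨⟨a, w⟩, rfl⟩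
      exact exists_code_of_optSet hdisj hcover hC hS a w
    · rintro ⟨κ, hκ, rfl⟩
      obtain ⟨a, w, h⟩ := exists_optSet_of_code hdisj hcover hC hS hκ
      exact ⟨(a, w), h⟩
  rw [numFaces_hansenPolytope, h, (injOn_codeVerts hdisj hcover hC hS).ncard_image,
    ncard_faceCodes, pG_eq_ncard G C S hdisj hcover]

/-- For a split graph `G = C ∪ S` on `d − 1` vertices (`d = n + 1`): `p_G(C,S)` is
divisible by `16`, so `s(H(G)) = 3^d + 16·ℓ` for some `ℓ ∈ ℕ`; moreover `ℓ = 0`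
(equivalently `p_G(C,S) = 0`) holds exactly when `G` is a threshold graph. -/
theorem hansen_split_sixteen {n : ℕ} (G : SimpleGraph (Fin n))
    (C S : Finset (Fin n)) (hdisj : Disjoint C S) (hcover : C ∪ S = Finset.univ)
    (hC : G.IsClique (↑C : Set (Fin n))) (hS : IsStable G S) :
    16 ∣ pG G C S ∧
      (pG G C S = 0 ↔ IsThresholdGraph G) ∧
      ∃ ℓ : ℕ, numFaces (hansenPolytope G) = 3 ^ (n + 1) + 16 * ℓ ∧
        (ℓ = 0 ↔ IsThresholdGraph G) := by
  have h16 : 16 ∣ pG G C S :=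
    pG_eq_ncard G C S hdisj hcover ▸ sixteen_dvd_ncard G C S hdisj hcover
  have h0 := pG_eq_zero_iff hdisj hcover hC hS
  refine ⟨h16, h0, ?_⟩
  obtain ⟨ℓ, hℓ⟩ := h16
  refine ⟨ℓ, by rw [numFaces_hansenPolytope_split G C S hdisj hcover hC hS, hℓ], ?_⟩
  rw [← h0, hℓ]
  omega
end
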